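/- (Beresnevich–Dickinson–Velani–Vaughan divergence theorem for planar curves.) Let ψ₁, ψ₂ : ℕ → (0,∞) be approximating functions. If Σ_{q=1}^∞ ψ₁(q) ψ₂(q) = ∞, then for Lebesgue-almost every x ∈ I the point (x, f(x)) belongs to S₂(ψ₁, ψ₂); that is, C_f ∩ S₂(ψ₁,ψ₂) has full induced measure on C_f. -/

import Mathlib

open MeasureTheory

/-- Distance from `x` to the nearest integer, `‖x‖ = min_{z ∈ ℤ} |x - z|`. -/
noncomputable def nint (x : ℝ) : ℝ := ⨅ z : ℤ, |x - (z : ℝ)|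

/-- If every point of `W` is the centre of a ball on which some member of the family `φ`
indexed by `P` stays below `ρ`, then an upper bound for the measure of `W` can be checked on those
subintervals on which every member of the family reaches `ρ`. -/
theorem volume_le_of_local_bound {ι : Type*} (φ : ι → ℝ → ℝ) (P : Set ι) (s t ρ K : ℝ)
    (hK : 0 ≤ K) (hφ : ∀ i ∈ P, ContinuousOn (φ i) (Set.Icc s t))
    (hbig : ∀ i ∈ P, ∃ y ∈ Set.Icc s t, ρ ≤ φ i y) (W : Set ℝ) (hW : W ⊆ Set.Icc s t)
    (hsmall : ∀ x ∈ W, ∃ i ∈ P, φ i x < ρ)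
    (hloc : ∀ i ∈ P, ∀ s' t', s ≤ s' → s' ≤ t' → t' ≤ t →
      (∀ j ∈ P, ∃ y ∈ Set.Icc s' t', ρ ≤ φ j y) →
      volume (W ∩ {x | φ i x < ρ} ∩ Set.Icc s' t') ≤ ENNReal.ofReal (K * (t' - s'))) :
    volume W ≤ ENNReal.ofReal (2 * Besicovitch.multiplicity ℝ * K * (t - s)) := by
  rcases W.eq_empty_or_nonempty with rfl | ⟨x₀, hx₀⟩
  · simp
  have : Nonempty ι := ⟨(hsmall x₀ hx₀).choose⟩
  have hrad : ∀ x ∈ W, ∃ i ∈ P, ∃ r : ℝ, 0 < r ∧ r ≤ t - s ∧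
      (∀ y ∈ Set.Icc s t, |y - x| ≤ r → φ i y < ρ) ∧
      (∀ j ∈ P, ∃ y ∈ Set.Icc s t, |y - x| ≤ 2 * r ∧ ρ ≤ φ j y) := by
    intro x hx
    set R : Set ℝ := {r | 0 < r ∧ ∃ i ∈ P, ∀ y ∈ Set.Icc s t, |y - x| ≤ r → φ i y < ρ} with hR
    have hxI := hW hx
    have hub : ∀ r ∈ R, r ≤ t - s := by
      rintro r ⟨hr, i, hi, hlt⟩
      by_contra! hcon
      obtain ⟨y, hy, hyρ⟩ := hbig i hi
      have : φ i y < ρ := hlt y hy (by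
        rw [abs_le]
        constructor <;> linarith [hy.1, hy.2, hxI.1, hxI.2])
      linarith
    have hne : R.Nonempty := by
      obtain ⟨i, hi, hlt⟩ := hsmall x hx
      have hc := (hφ i hi) x hxI
      have := hc.eventually (gt_mem_nhds hlt)
      rw [eventually_nhdsWithin_iff, Metric.eventually_nhds_iff] at this
      obtain ⟨ε, hε, h⟩ := this
      refine ⟨ε / 2, by positivity, i, hi, fun y hy hyx => h ?_ hy⟩
      rw [Real.dist_eq]; linarith
    have hbdd : BddAbove R := ⟨t - s, hub⟩
    have hpos : 0 < sSup R := by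
      obtain ⟨r, hr⟩ := hne
      exact lt_of_lt_of_le hr.1 (le_csSup hbdd hr)
    obtain ⟨r, hr, hlt⟩ := exists_lt_of_lt_csSup hne (half_lt_self hpos)
    obtain ⟨hr0, i, hi, hri⟩ := id hr
    refine ⟨i, hi, r, hr0, hub r hr, hri, fun j hj => ?_⟩
    by_contra! hcon
    have : 2 * r ∈ R := ⟨by positivity, j, hj, hcon⟩
    have := le_csSup hbdd this
    linarith
  choose! i hiP r hr0 hrle hri hrbig using hrad
  set q : Besicovitch.BallPackage W ℝ :=
    { c := fun x => x, r := fun x => r x, rpos := fun x => hr0 x x.2,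
      r_bound := t - s, r_le := fun x => hrle x x.2 } with hq
  obtain ⟨S, hSd, hScov⟩ := Besicovitch.exist_disjoint_covering_families
    (Besicovitch.one_lt_goodτ ℝ) (Besicovitch.isEmpty_satelliteConfig_multiplicity ℝ) q
  have hcount : ∀ k, (S k).Countable := fun k =>
    (hSd k).countable_of_nonempty_interior fun j _ =>
      (Metric.nonempty_ball.2 (q.rpos j)).mono Metric.ball_subset_interior_closedBall
  have hWsub : W ⊆ ⋃ k, ⋃ j ∈ S k, W ∩ Metric.closedBall (q.c j) (q.r j) := by
    intro x hx
    have := hScov ⟨⟨x, hx⟩, rfl⟩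
    simp only [Set.mem_iUnion] at this ⊢
    obtain ⟨k, j, hj, hm⟩ := this
    exact ⟨k, j, hj, hx, Metric.ball_subset_closedBall hm⟩
  have hball : ∀ x : W, volume (W ∩ Metric.closedBall (q.c x) (q.r x)) ≤
      ENNReal.ofReal (2 * K) * volume (Set.Icc s t ∩ Metric.closedBall (q.c x) (q.r x)) := by
    rintro ⟨x, hx⟩
    have hxI := hW hx
    have h0 := hr0 x hx
    have e1 : Set.Icc s t ∩ Metric.closedBall x (r x) =
        Set.Icc (max s (x - r x)) (min t (x + r x)) := by
      rw [Real.closedBall_eq_Icc, Set.Icc_inter_Icc]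
    have hsub : W ∩ Metric.closedBall x (r x) ⊆ W ∩ {y | φ (i x) y < ρ} ∩
        Set.Icc (max s (x - 2 * r x)) (min t (x + 2 * r x)) := by
      rintro y ⟨hy, hyb⟩
      have hyb' : |y - x| ≤ r x := by rwa [Metric.mem_closedBall, Real.dist_eq] at hyb
      have hyI := hW hy
      refine ⟨⟨hy, hri x hx y hyI hyb'⟩, ?_⟩
      rw [abs_le] at hyb'
      exact ⟨max_le hyI.1 (by linarith), le_min hyI.2 (by linarith)⟩
    have h1 := hloc (i x) (hiP x hx) (max s (x - 2 * r x)) (min t (x + 2 * r x))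
      (le_max_left _ _) (max_le (le_min (hxI.1.trans hxI.2) (by linarith [hxI.1]))
        (le_min (by linarith [hxI.2]) (by linarith))) (min_le_left _ _) (by
        intro j hj
        obtain ⟨y, hyI, hyx, hyρ⟩ := hrbig x hx j hj
        rw [abs_le] at hyx
        exact ⟨y, ⟨max_le hyI.1 (by linarith), le_min hyI.2 (by linarith)⟩, hyρ⟩)
    change volume (W ∩ Metric.closedBall x (r x)) ≤
      _ * volume (Set.Icc s t ∩ Metric.closedBall x (r x))
    rw [e1, Real.volume_Icc, ← ENNReal.ofReal_mul (by positivity)]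
    refine (measure_mono hsub).trans (h1.trans (ENNReal.ofReal_le_ofReal ?_))
    have a1 : min t (x + 2 * r x) - x ≤ 2 * (min t (x + r x) - x) := by
      rcases le_total t (x + r x) with h | h
      · rw [min_eq_left h]; linarith [min_le_left t (x + 2 * r x), hxI.2]
      · rw [min_eq_right h]; linarith [min_le_right t (x + 2 * r x)]
    have a2 : x - max s (x - 2 * r x) ≤ 2 * (x - max s (x - r x)) := by
      rcases le_total s (x - r x) with h | h
      · rw [max_eq_right h]; linarith [le_max_right s (x - 2 * r x)]
      · rw [max_eq_left h]; linarith [le_max_left s (x - 2 * r x), hxI.1]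
    nlinarith
  have hfam : ∀ k, volume (⋃ j ∈ S k, W ∩ Metric.closedBall (q.c j) (q.r j)) ≤
      ENNReal.ofReal (2 * K) * ENNReal.ofReal (t - s) := by
    intro k
    calc volume (⋃ j ∈ S k, W ∩ Metric.closedBall (q.c j) (q.r j))
        ≤ ∑' j : S k, volume (W ∩ Metric.closedBall (q.c j) (q.r j)) :=
          measure_biUnion_le volume (hcount k) _
      _ ≤ ∑' j : S k, ENNReal.ofReal (2 * K) *
            volume (Set.Icc s t ∩ Metric.closedBall (q.c j) (q.r j)) :=
          ENNReal.tsum_le_tsum fun j => hball j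
      _ = ENNReal.ofReal (2 * K) *
            volume (⋃ j ∈ S k, Set.Icc s t ∩ Metric.closedBall (q.c j) (q.r j)) := by
          rw [ENNReal.tsum_mul_left, measure_biUnion (hcount k)]
          · exact (hSd k).mono fun j => Set.inter_subset_right
          · exact fun j _ => measurableSet_Icc.inter Metric.isClosed_closedBall.measurableSet
      _ ≤ ENNReal.ofReal (2 * K) * ENNReal.ofReal (t - s) := by
          gcongr
          rw [← Real.volume_Icc]
          exact measure_mono (Set.iUnion₂_subset fun j _ => Set.inter_subset_left)
  calc volume W ≤ volume (⋃ k, ⋃ j ∈ S k, W ∩ Metric.closedBall (q.c j) (q.r j)) :=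
        measure_mono hWsub
    _ ≤ ∑ k, volume (⋃ j ∈ S k, W ∩ Metric.closedBall (q.c j) (q.r j)) :=
        measure_iUnion_fintype_le _ _
    _ ≤ ∑ _k : Fin (Besicovitch.multiplicity ℝ),
          ENNReal.ofReal (2 * K) * ENNReal.ofReal (t - s) := Finset.sum_le_sum fun k _ => hfam k
    _ = _ := by
        rw [Finset.sum_const, Finset.card_univ, Fintype.card_fin, nsmul_eq_mul,
          ← ENNReal.ofReal_mul (by positivity), ← ENNReal.ofReal_natCast,
          ← ENNReal.ofReal_mul (by positivity)]
        congr 1; ring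

/-- Quantitative nondivergence for a two-level family of functions: the relation `R` says which
pairs of indices are comparable. -/
theorem volume_le_of_flags {ι : Type*} (φ : ι → ℝ → ℝ) (R : ι → ι → Prop) (s t ρ ε K : ℝ)
    (hK : 0 ≤ K) (hφ : ∀ i, ContinuousOn (φ i) (Set.Icc s t))
    (hbig : ∀ i, ∃ y ∈ Set.Icc s t, ρ ≤ φ i y)
    (hgood : ∀ i, ∀ s' t', s ≤ s' → s' ≤ t' → t' ≤ t → (∃ y ∈ Set.Icc s' t', ρ ≤ φ i y) →
      volume {x | x ∈ Set.Icc s' t' ∧ φ i x < ε} ≤ ENNReal.ofReal (K * (t' - s')))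
    (E : Set ℝ) (hE : E ⊆ Set.Icc s t) (h0 : ∀ x ∈ E, ∃ i, φ i x < ρ)
    (h1 : ∀ x ∈ E, ∀ i, φ i x < ρ → φ i x < ε ∨ ∃ j, R i j ∧ φ j x < ρ)
    (h2 : ∀ x ∈ E, ∀ i j, R i j → φ i x < ρ → φ j x < ρ → φ i x < ε ∨ φ j x < ε) :
    volume E ≤ ENNReal.ofReal (2 * Besicovitch.multiplicity ℝ *
      ((1 + 2 * Besicovitch.multiplicity ℝ) * K) * (t - s)) := by
  refine volume_le_of_local_bound φ Set.univ s t ρ _ (by positivity) (fun i _ => hφ i)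
    (fun i _ => hbig i) E hE (fun x hx => (h0 x hx).imp fun i hi => ⟨trivial, hi⟩) ?_
  intro i _ s' t' hs hst ht hbig'
  set W : Set ℝ := {x | x ∈ E ∧ x ∈ Set.Icc s' t' ∧ φ i x < ρ ∧ ¬ φ i x < ε} with hWdef
  have hW := volume_le_of_local_bound φ {j | R i j} s' t' ρ K hK
    (fun j _ => (hφ j).mono (Set.Icc_subset_Icc hs ht)) (fun j _ => hbig' j trivial) W
    (fun x hx => hx.2.1) (fun x hx => (h1 x hx.1 i hx.2.2.1).resolve_left hx.2.2.2) (by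
      intro j hj s'' t'' hs' hst' ht' hbig''
      refine le_trans (measure_mono ?_) (hgood j s'' t'' (hs.trans hs') hst' (ht'.trans ht)
        (hbig'' j hj))
      rintro x ⟨⟨hxW, hxj⟩, hxI⟩
      exact ⟨hxI, (h2 x hxW.1 i j hj hxW.2.2.1 hxj).resolve_left hxW.2.2.2⟩)
  have hsub : E ∩ {x | φ i x < ρ} ∩ Set.Icc s' t' ⊆ {x | x ∈ Set.Icc s' t' ∧ φ i x < ε} ∪ W := by
    rintro x ⟨⟨hxE, hxi⟩, hxI⟩
    by_cases h : φ i x < ε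
    · exact Or.inl ⟨hxI, h⟩
    · exact Or.inr ⟨hxE, hxI, hxi, h⟩
  refine (measure_mono hsub).trans ((measure_union_le _ _).trans
    ((add_le_add (hgood i s' t' hs hst ht (hbig' i trivial)) hW).trans ?_))
  have : 0 ≤ t' - s' := by linarith
  rw [← ENNReal.ofReal_add (by positivity) (by positivity)]
  exact ENNReal.ofReal_le_ofReal (le_of_eq (by ring))

/-- On `[s, t]` the increments of `ℓ` lie between `m * l` and `M * l` times those of the
variable. -/
def SlopeBounds (m M l s t : ℝ) (ℓ : ℝ → ℝ) : Prop :=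
  ∀ x y, s ≤ x → x ≤ y → y ≤ t → m * l * (y - x) ≤ ℓ y - ℓ x ∧ ℓ y - ℓ x ≤ M * l * (y - x)

/-- The constant in the sublevel set estimates. -/
noncomputable def sublevelConst (m M : ℝ) : ℝ := 1 + 24 * (M / m) ^ 2

theorem volume_le_of_sub_le {A : Set ℝ} {d : ℝ} (h : ∀ x ∈ A, ∀ y ∈ A, x < y → y - x ≤ d)
    (hd : 0 ≤ d) : volume A ≤ ENNReal.ofReal d := by
  refine (Real.volume_le_diam A).trans (Metric.ediam_le fun x hx y hy => ?_)
  rw [edist_dist, Real.dist_eq]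
  refine ENNReal.ofReal_le_ofReal ?_
  rcases lt_trichotomy x y with hxy | rfl | hxy
  · rw [abs_sub_comm, abs_of_pos (by linarith)]; exact h x hx y hy hxy
  · simpa using hd
  · rw [abs_of_pos (by linarith)]; exact h y hy x hx hxy

theorem volume_le_of_mul_sq_le {A : Set ℝ} {S C e L : ℝ} (hS : 0 < S) (hC : 0 ≤ C) (he : 0 ≤ e)
    (hL : 0 ≤ L) (h : ∀ x ∈ A, ∀ y ∈ A, x < y → S * (y - x) ^ 2 ≤ C * e * L ^ 2) :
    volume A ≤ ENNReal.ofReal (√(C * (e / S)) * L) := by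
  refine volume_le_of_sub_le (fun x hx y hy hxy => ?_) (by positivity)
  have h1 := h x hx y hy hxy
  have h2 : (y - x) ^ 2 ≤ (C * (e / S)) * L ^ 2 := by
    have : (C * (e / S)) * L ^ 2 = C * e * L ^ 2 / S := by ring
    rw [this, le_div_iff₀ hS]; linarith
  calc y - x ≤ √((C * (e / S)) * L ^ 2) := Real.le_sqrt_of_sq_le h2
    _ = _ := by rw [Real.sqrt_mul (by positivity), Real.sqrt_sq hL]

theorem SlopeBounds.volume_abs_lt_le {m M l s t e S : ℝ} {ℓ : ℝ → ℝ} (hm : 0 < m) (hmM : m ≤ M)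
    (hl : 0 ≤ l) (hℓ : SlopeBounds m M l s t ℓ) (he : 0 < e) (hS : 0 < S) {y₀ : ℝ}
    (hy₀ : y₀ ∈ Set.Icc s t) (hSy : S ≤ |ℓ y₀|) :
    volume {x | x ∈ Set.Icc s t ∧ |ℓ x| < e} ≤
      ENNReal.ofReal (√(sublevelConst m M * (e / S)) * (t - s)) := by
  have hst : s ≤ t := hy₀.1.trans hy₀.2
  refine volume_le_of_mul_sq_le hS (by unfold sublevelConst; positivity) he.le (by linarith) ?_
  rintro x ⟨hx, hxe⟩ y ⟨hy, hye⟩ hxy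
  rw [abs_lt] at hxe hye
  have h1 := (hℓ x y hx.1 hxy.le hy.2).1
  have h2 : |ℓ y₀| ≤ e + M * l * (t - s) := by
    have hMl : 0 ≤ M * l := by have := hm.trans_le hmM; positivity
    have hml : 0 ≤ m * l := by positivity
    rw [abs_le]
    rcases le_total x y₀ with h | h
    · have := hℓ x y₀ hx.1 h hy₀.2
      have h3 : M * l * (y₀ - x) ≤ M * l * (t - s) :=
        mul_le_mul_of_nonneg_left (by linarith [hx.1, hy₀.2]) hMl
      have h4 : 0 ≤ m * l * (y₀ - x) := mul_nonneg hml (by linarith)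
      constructor <;> nlinarith
    · have := hℓ y₀ x hy₀.1 h hx.2
      have h3 : M * l * (x - y₀) ≤ M * l * (t - s) :=
        mul_le_mul_of_nonneg_left (by linarith [hx.2, hy₀.1]) hMl
      have h4 : 0 ≤ m * l * (x - y₀) := mul_nonneg hml (by linarith)
      constructor <;> nlinarith
  set d := y - x with hd
  set L := t - s with hL
  have hdL : d ≤ L := by linarith [hx.1, hy.2]
  have hd0 : 0 < d := by linarith
  have hL0 : 0 < L := by linarith
  set k := M / m with hk
  have hMk : M = k * m := by rw [hk]; field_simp
  have hk1 : 1 ≤ k := by rw [hk, le_div_iff₀ hm]; linarith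
  have h3 : m * l * d ≤ 2 * e := by linarith
  have h4 : S * d ≤ (1 + 2 * k) * e * L := by
    calc S * d ≤ (e + M * l * L) * d := by gcongr; linarith
      _ = e * d + k * L * (m * l * d) := by rw [hMk]; ring
      _ ≤ e * L + k * L * (2 * e) := by gcongr
      _ = _ := by ring
  calc S * d ^ 2 = S * d * d := by ring
    _ ≤ (1 + 2 * k) * e * L * L := by gcongr
    _ = (1 + 2 * k) * (e * L ^ 2) := by ring
    _ ≤ sublevelConst m M * (e * L ^ 2) := by
        gcongr; unfold sublevelConst; nlinarith
    _ = _ := by ring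

theorem SlopeBounds.mul_sq_le {m M l s t e S : ℝ} {ℓ G h : ℝ → ℝ} (hm : 0 < m) (hmM : m ≤ M)
    (hl : 0 ≤ l) (hℓ : SlopeBounds m M l s t ℓ) (he : 0 < e)
    (hh : ∀ u ∈ Set.Icc s t, m ≤ h u ∧ h u ≤ M)
    (hG : ∀ u ∈ Set.Icc s t, HasDerivAt G (h u * ℓ u) u) {x y y₀ : ℝ} (hx : s ≤ x) (hxy : x < y)
    (hy : y ≤ t) (hy₀ : y₀ ∈ Set.Icc s t) (hSy : S ≤ |G y₀|) (hxe : |G x| < e) (hye : |G y| < e)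
    (hℓx : 0 ≤ ℓ x) :
    S * (y - x) ^ 2 ≤ sublevelConst m M * e * (t - s) ^ 2 := by
  have hM : 0 < M := hm.trans_le hmM
  have mvt : ∀ a b, s ≤ a → a < b → b ≤ t →
      ∃ ξ, a < ξ ∧ ξ < b ∧ G b - G a = h ξ * ℓ ξ * (b - a) := by
    intro a b ha hab hb
    obtain ⟨ξ, hξ, he⟩ := exists_hasDerivAt_eq_slope G (fun u => h u * ℓ u) hab
      (fun u hu => (hG u ⟨ha.trans hu.1, hu.2.trans hb⟩).continuousAt.continuousWithinAt)
      (fun u hu => hG u ⟨ha.trans hu.1.le, hu.2.le.trans hb⟩)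
    refine ⟨ξ, hξ.1, hξ.2, ?_⟩
    have : b - a ≠ 0 := by linarith [hab] |> fun (h : 0 < b - a) => h.ne'
    rw [he]; field_simp
  rw [abs_lt] at hxe hye
  have hml : 0 ≤ m * l := by positivity
  have hMl : 0 ≤ M * l := by positivity
  set d := y - x with hd
  set L := t - s with hL
  have hd0 : 0 < d := by linarith
  have hdL : d ≤ L := by linarith
  have hL0 : 0 < L := by linarith
  have hmono : ∀ u, x ≤ u → u ≤ t → m * l * (u - x) ≤ ℓ u := fun u hu hut => by
    linarith [(hℓ x u hx hu hut).1]
  have hpos : ∀ u, x ≤ u → u ≤ t → 0 ≤ ℓ u := fun u hu hut =>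
    (mul_nonneg hml (by linarith)).trans (hmono u hu hut)
  have hA : m ^ 2 * (l * d ^ 2) ≤ 8 * e := by
    obtain ⟨ξ, h1, h2, h3⟩ := mvt ((x + y) / 2) y (by linarith) (by linarith) hy
    obtain ⟨η, k1, k2, k3⟩ := mvt x ((x + y) / 2) hx (by linarith) (by linarith)
    have e1 : 0 ≤ h η * ℓ η * ((x + y) / 2 - x) :=
      mul_nonneg (mul_nonneg (hm.le.trans (hh η ⟨by linarith, by linarith⟩).1)
        (hpos η (by linarith) (by linarith))) (by linarith)
    have e2 : m * (m * l * (d / 2)) ≤ h ξ * ℓ ξ := by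
      refine mul_le_mul (hh ξ ⟨by linarith, by linarith⟩).1 ?_ (by positivity)
        (hm.le.trans (hh ξ ⟨by linarith, by linarith⟩).1)
      refine le_trans ?_ (hmono ξ (by linarith) (by linarith))
      gcongr; linarith
    have e3 : m * (m * l * (d / 2)) * (d / 2) ≤ h ξ * ℓ ξ * (y - (x + y) / 2) := by
      have : y - (x + y) / 2 = d / 2 := by rw [hd]; ring
      rw [this]; gcongr
    have e4 : m * (m * l * (d / 2)) * (d / 2) = m ^ 2 * (l * d ^ 2) / 4 := by ring
    linarith
  have hSb : S ≤ e + M * (ℓ y + M * l * L) * L := by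
    have key : ∀ a b, s ≤ a → a < b → b ≤ t → (a = y ∨ b = y) →
        |G b - G a| ≤ M * (ℓ y + M * l * L) * L := by
      intro a b ha hab hb hor
      obtain ⟨ξ, h1, h2, h3⟩ := mvt a b ha hab hb
      have hξ : |ℓ ξ| ≤ ℓ y + M * l * L := by
        have hy0 := hpos y hxy.le hy
        have h5 : ∀ c, c ≤ L → M * l * c ≤ M * l * L := fun c hc =>
          mul_le_mul_of_nonneg_left hc hMl
        rw [abs_le]
        rcases le_total y ξ with h | h
        · have := hℓ y ξ (by linarith) h (by linarith)
          have h6 := h5 (ξ - y) (by linarith)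
          have h7 : 0 ≤ m * l * (ξ - y) := mul_nonneg hml (by linarith)
          constructor <;> linarith
        · have := hℓ ξ y (by linarith) h (by linarith)
          have h6 := h5 (y - ξ) (by linarith)
          have h7 : 0 ≤ m * l * (y - ξ) := mul_nonneg hml (by linarith)
          have h8 : 0 ≤ M * l * L := by positivity
          constructor <;> linarith
      have hhξ := hh ξ ⟨by linarith, by linarith⟩
      rw [h3, abs_mul, abs_mul, abs_of_pos (hm.trans_le hhξ.1), abs_of_pos (by linarith : 0 < b - a)]
      have := hpos y hxy.le hy
      gcongr
      · exact hhξ.2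
      · linarith
    have h0 := hpos y hxy.le hy
    rcases lt_trichotomy y y₀ with h | h | h
    · have := key y y₀ (by linarith) h hy₀.2 (Or.inl rfl)
      have h2 := abs_sub_abs_le_abs_sub (G y₀) (G y)
      have h3 : |G y| < e := abs_lt.2 hye
      linarith
    · rw [← h] at hSy
      have h3 : |G y| < e := abs_lt.2 hye
      have : 0 ≤ M * (ℓ y + M * l * L) * L := by positivity
      linarith
    · have := key y₀ y hy₀.1 h hy (Or.inr rfl)
      have h2 := abs_sub_abs_le_abs_sub (G y₀) (G y)
      rw [abs_sub_comm] at h2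
      have h3 : |G y| < e := abs_lt.2 hye
      linarith
  set k := M / m with hk
  have hMk : M = k * m := by rw [hk]; field_simp
  have hk1 : 1 ≤ k := by rw [hk, le_div_iff₀ hm]; linarith
  have hC : sublevelConst m M = 1 + 24 * k ^ 2 := rfl
  have hd2 : e * d ^ 2 ≤ e * L ^ 2 := by gcongr
  rcases le_total (ℓ y) (2 * M * l * L) with hcase | hcase
  · have h5 : S ≤ e + 3 * M ^ 2 * l * L ^ 2 := by
      have : M * (ℓ y + M * l * L) * L ≤ M * (2 * M * l * L + M * l * L) * L := by gcongr
      have e5 : M * (2 * M * l * L + M * l * L) * L = 3 * M ^ 2 * l * L ^ 2 := by ring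
      linarith
    calc S * d ^ 2 ≤ (e + 3 * M ^ 2 * l * L ^ 2) * d ^ 2 := by gcongr
      _ = e * d ^ 2 + 3 * k ^ 2 * L ^ 2 * (m ^ 2 * (l * d ^ 2)) := by rw [hMk]; ring
      _ ≤ e * L ^ 2 + 3 * k ^ 2 * L ^ 2 * (8 * e) := by gcongr
      _ = _ := by rw [hC]; ring
  · have hB : m * (ℓ y * d) ≤ 4 * e := by
      obtain ⟨ξ, h1, h2, h3⟩ := mvt x y hx hxy hy
      have e1 : ℓ y / 2 ≤ ℓ ξ := by
        have := (hℓ ξ y (by linarith) h2.le hy).2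
        have h6 : M * l * (y - ξ) ≤ M * l * L := by gcongr; linarith
        linarith
      have hy0 := hpos y hxy.le hy
      have e2 : m * (ℓ y / 2) ≤ h ξ * ℓ ξ :=
        mul_le_mul (hh ξ ⟨by linarith, by linarith⟩).1 e1 (by positivity)
          (hm.le.trans (hh ξ ⟨by linarith, by linarith⟩).1)
      have e3 : m * (ℓ y / 2) * d ≤ h ξ * ℓ ξ * (y - x) := by gcongr
      have e4 : m * (ℓ y / 2) * d = m * (ℓ y * d) / 2 := by ring
      linarith
    have h5 : S ≤ e + 3 / 2 * M * ℓ y * L := by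
      have : M * (ℓ y + M * l * L) * L ≤ M * (ℓ y + ℓ y / 2) * L := by gcongr; linarith
      have e5 : M * (ℓ y + ℓ y / 2) * L = 3 / 2 * M * ℓ y * L := by ring
      linarith
    have hy0 := hpos y hxy.le hy
    calc S * d ^ 2 ≤ (e + 3 / 2 * M * ℓ y * L) * d ^ 2 := by gcongr
      _ = e * d ^ 2 + 3 / 2 * k * (L * d) * (m * (ℓ y * d)) := by rw [hMk]; ring
      _ ≤ e * L ^ 2 + 3 / 2 * k * (L * L) * (4 * e) := by gcongr
      _ = (1 + 6 * k) * (e * L ^ 2) := by ring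
      _ ≤ (1 + 24 * k ^ 2) * (e * L ^ 2) :=
          mul_le_mul_of_nonneg_right (by nlinarith only [hk1]) (by positivity)
      _ = _ := by rw [hC]; ring

/-- Sublevel sets of a function whose derivative is comparable to a function with bounded
slopes. -/
theorem SlopeBounds.volume_primitive_lt_le {m M l s t e S : ℝ} {ℓ G h : ℝ → ℝ} (hm : 0 < m)
    (hmM : m ≤ M) (hl : 0 ≤ l) (hℓ : SlopeBounds m M l s t ℓ) (he : 0 < e) (hS : 0 < S)
    (hh : ∀ u ∈ Set.Icc s t, m ≤ h u ∧ h u ≤ M)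
    (hG : ∀ u ∈ Set.Icc s t, HasDerivAt G (h u * ℓ u) u) {y₀ : ℝ}
    (hy₀ : y₀ ∈ Set.Icc s t) (hSy : S ≤ |G y₀|) :
    volume {x | x ∈ Set.Icc s t ∧ |G x| < e} ≤
      ENNReal.ofReal (2 * √(sublevelConst m M * (e / S)) * (t - s)) := by
  have hst : 0 ≤ t - s := by linarith [hy₀.1, hy₀.2]
  have hC : 0 ≤ sublevelConst m M := by unfold sublevelConst; positivity
  have h1 : volume {x | (x ∈ Set.Icc s t ∧ |G x| < e) ∧ 0 ≤ ℓ x} ≤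
      ENNReal.ofReal (√(sublevelConst m M * (e / S)) * (t - s)) :=
    volume_le_of_mul_sq_le hS hC he.le hst fun x hx y hy hxy =>
      hℓ.mul_sq_le hm hmM hl he hh hG hx.1.1.1 hxy hy.1.1.2 hy₀ hSy hx.1.2 hy.1.2 hx.2
  have h2 : volume {x | (x ∈ Set.Icc s t ∧ |G x| < e) ∧ ℓ x ≤ 0} ≤
      ENNReal.ofReal (√(sublevelConst m M * (e / S)) * (t - s)) := by
    refine volume_le_of_mul_sq_le hS hC he.le hst fun x hx y hy hxy => ?_
    have hℓ' : SlopeBounds m M l (-t) (-s) (fun u => -ℓ (-u)) := by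
      intro a b ha hab hb
      have := hℓ (-b) (-a) (by linarith) (by linarith) (by linarith)
      constructor <;> linarith
    have key := hℓ'.mul_sq_le (G := fun u => G (-u)) (h := fun u => h (-u)) (e := e) (S := S)
      (x := -y) (y := -x) (y₀ := -y₀) hm hmM hl he
      (fun u hu => hh (-u) ⟨by linarith [hu.2], by linarith [hu.1]⟩)
      (fun u hu => by
        have := (hG (-u) ⟨by linarith [hu.2], by linarith [hu.1]⟩).comp u (hasDerivAt_neg u)
        exact this.congr_deriv (by ring))
      (by linarith [hy.1.1.2]) (by linarith) (by linarith [hx.1.1.1])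
      ⟨by linarith [hy₀.2], by linarith [hy₀.1]⟩ (by simpa using hSy) (by simpa using hy.1.2)
      (by simpa using hx.1.2) (by simpa using hy.2)
    have e1 : -x - -y = y - x := by ring
    have e2 : -s - -t = t - s := by ring
    rwa [e1, e2] at key
  have hsub : {x | x ∈ Set.Icc s t ∧ |G x| < e} ⊆
      {x | (x ∈ Set.Icc s t ∧ |G x| < e) ∧ 0 ≤ ℓ x} ∪
        {x | (x ∈ Set.Icc s t ∧ |G x| < e) ∧ ℓ x ≤ 0} := fun x hx =>
    (le_total 0 (ℓ x)).imp (fun h => ⟨hx, h⟩) fun h => ⟨hx, h⟩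
  refine (measure_mono hsub).trans ((measure_union_le _ _).trans ((add_le_add h1 h2).trans ?_))
  rw [← ENNReal.ofReal_add (by positivity) (by positivity)]
  exact ENNReal.ofReal_le_ofReal (le_of_eq (by ring))

/-- A planar arc `t ↦ (X t, Y t)` over `[α, β]` with slope `σ = dY / dX`, such that `X` and `σ` are
increasing with derivatives `X'`, `σ'` between `m` and `M`. -/
structure PlanarArc (m M α β : ℝ) (X Y σ X' σ' : ℝ → ℝ) : Prop where
  pos : 0 < m
  le : m ≤ M
  hasDerivAt_X : ∀ t ∈ Set.Icc α β, HasDerivAt X (X' t) t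
  hasDerivAt_Y : ∀ t ∈ Set.Icc α β, HasDerivAt Y (X' t * σ t) t
  hasDerivAt_slope : ∀ t ∈ Set.Icc α β, HasDerivAt σ (σ' t) t
  bounds_X : ∀ t ∈ Set.Icc α β, m ≤ X' t ∧ X' t ≤ M
  bounds_slope : ∀ t ∈ Set.Icc α β, m ≤ σ' t ∧ σ' t ≤ M
  abs_slope_le : ∀ t ∈ Set.Icc α β, |σ t| ≤ M

theorem PlanarArc.mono {m M α β α' β' : ℝ} {X Y σ X' σ' : ℝ → ℝ}
    (h : PlanarArc m M α β X Y σ X' σ') (hα : α ≤ α') (hβ : β' ≤ β) :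
    PlanarArc m M α' β' X Y σ X' σ' where
  pos := h.pos
  le := h.le
  hasDerivAt_X t ht := h.hasDerivAt_X t ⟨hα.trans ht.1, ht.2.trans hβ⟩
  hasDerivAt_Y t ht := h.hasDerivAt_Y t ⟨hα.trans ht.1, ht.2.trans hβ⟩
  hasDerivAt_slope t ht := h.hasDerivAt_slope t ⟨hα.trans ht.1, ht.2.trans hβ⟩
  bounds_X t ht := h.bounds_X t ⟨hα.trans ht.1, ht.2.trans hβ⟩
  bounds_slope t ht := h.bounds_slope t ⟨hα.trans ht.1, ht.2.trans hβ⟩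
  abs_slope_le t ht := h.abs_slope_le t ⟨hα.trans ht.1, ht.2.trans hβ⟩

theorem exists_slope_eq {f f' : ℝ → ℝ} {s t a b : ℝ}
    (hf : ∀ u ∈ Set.Icc s t, HasDerivAt f (f' u) u) (ha : s ≤ a) (hab : a < b) (hb : b ≤ t) :
    ∃ ξ, a < ξ ∧ ξ < b ∧ f b - f a = f' ξ * (b - a) := by
  obtain ⟨ξ, hξ, he⟩ := exists_hasDerivAt_eq_slope f f' hab
    (fun u hu => (hf u ⟨ha.trans hu.1, hu.2.trans hb⟩).continuousAt.continuousWithinAt)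
    (fun u hu => hf u ⟨ha.trans hu.1.le, hu.2.le.trans hb⟩)
  have h0 : b - a ≠ 0 := (sub_pos.2 hab).ne'
  exact ⟨ξ, hξ.1, hξ.2, by rw [he]; field_simp⟩

theorem slopeBounds_affine {f f' : ℝ → ℝ} {m M s t l c : ℝ}
    (hf : ∀ u ∈ Set.Icc s t, HasDerivAt f (f' u) u) (hb : ∀ u ∈ Set.Icc s t, m ≤ f' u ∧ f' u ≤ M)
    (hl : 0 ≤ l) : SlopeBounds m M l s t fun u => l * f u + c := by
  intro x y hx hxy hy
  rcases hxy.eq_or_lt with rfl | hlt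
  · simp
  obtain ⟨ξ, h1, h2, h3⟩ := exists_slope_eq hf hx hlt hy
  have h4 := hb ξ ⟨by linarith, by linarith⟩
  have h5 : (l * f y + c) - (l * f x + c) = f' ξ * l * (y - x) := by
    calc _ = l * (f y - f x) := by ring
      _ = _ := by rw [h3]; ring
  rw [h5]
  have h6 : 0 ≤ y - x := by linarith
  constructor <;> gcongr <;> linarith

theorem exists_abs_eq_one_mul_eq_abs (q : ℝ) : ∃ g : ℝ, |g| = 1 ∧ g * q = |q| := by
  rcases le_total 0 q with h | h
  · exact ⟨1, by simp, by simp [abs_of_nonneg h]⟩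
  · exact ⟨-1, by simp, by simp [abs_of_nonpos h]⟩

section Forms

variable (X Y σ : ℝ → ℝ)

/-- Horizontal deviation of the rational point `v = (q, p, r)` from the arc. -/
def ptForm₂ (v : ℤ × ℤ × ℤ) (t : ℝ) : ℝ := v.1 * X t - v.2.1

/-- Deviation of the rational point `v = (q, p, r)` from the tangent line to the arc. -/
def ptForm₁ (v : ℤ × ℤ × ℤ) (t : ℝ) : ℝ :=
  v.1 * Y t - v.2.2 - σ t * (v.1 * X t - v.2.1)

/-- Size of a rational point relative to the arc. -/
noncomputable def ptHeight (d₁ d₂ d₃ : ℝ) (v : ℤ × ℤ × ℤ) (t : ℝ) : ℝ :=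
  max (|ptForm₁ X Y σ v t| / d₁) (max (|ptForm₂ X v t| / d₂) (|(v.1 : ℝ)| / d₃))

/-- Value of the line `w = (c, a, b)`, that is `c + a x + b y`, at the arc. -/
def lineForm (w : ℤ × ℤ × ℤ) (t : ℝ) : ℝ := w.1 + w.2.1 * X t + w.2.2 * Y t

/-- Derivative of `lineForm` with respect to `X`. -/
def lineSlope (w : ℤ × ℤ × ℤ) (t : ℝ) : ℝ := w.2.1 + w.2.2 * σ t

/-- Size of a rational line relative to the arc. -/
noncomputable def lineHeight (d₁ d₂ d₃ : ℝ) (w : ℤ × ℤ × ℤ) (t : ℝ) : ℝ :=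
  max (|lineForm X Y w t| * d₃) (max (|lineSlope σ w t| * d₂) (|(w.2.2 : ℝ)| * d₁))

end Forms

section Good

variable {m M α β : ℝ} {X Y σ X' σ' : ℝ → ℝ}

theorem PlanarArc.volume_ptHeight_lt_le (h : PlanarArc m M α β X Y σ X' σ') {d₁ d₂ d₃ ε ρ : ℝ}
    (h₁ : 0 < d₁) (h₂ : 0 < d₂) (hε : 0 < ε) (hερ : ε ≤ ρ) (v : ℤ × ℤ × ℤ)
    (hv : ∃ y ∈ Set.Icc α β, ρ ≤ ptHeight X Y σ d₁ d₂ d₃ v y) :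
    volume {x | x ∈ Set.Icc α β ∧ ptHeight X Y σ d₁ d₂ d₃ v x < ε} ≤
      ENNReal.ofReal (2 * √(sublevelConst m M * (ε / ρ)) * (β - α)) := by
  obtain ⟨y, hy, hle⟩ := hv
  have hρ : 0 < ρ := hε.trans_le hερ
  have hαβ : 0 ≤ β - α := by linarith [hy.1, hy.2]
  obtain ⟨g, hg, hgq⟩ := exists_abs_eq_one_mul_eq_abs (v.1 : ℝ)
  have hℓ : SlopeBounds m M |(v.1 : ℝ)| α β fun u => |(v.1 : ℝ)| * X u + -(g * v.2.1) :=
    slopeBounds_affine h.hasDerivAt_X h.bounds_X (abs_nonneg _)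
  have hℓeq : ∀ u, |(v.1 : ℝ)| * X u + -(g * v.2.1) = g * ptForm₂ X v u := fun u => by
    rw [← hgq, ptForm₂]; ring
  have hscale : ∀ d, 0 < d → ε * d / (ρ * d) = ε / ρ := fun d hd => by field_simp
  rw [ptHeight, le_max_iff, le_max_iff] at hle
  rcases hle with hle | hle | hle
  · rw [le_div_iff₀ h₁] at hle
    have key := hℓ.volume_primitive_lt_le (G := fun u => -(g * ptForm₁ X Y σ v u)) (h := σ')
      (e := ε * d₁) (S := ρ * d₁) h.pos h.le (abs_nonneg _) (by positivity) (by positivity)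
      h.bounds_slope (fun u hu => by
        rw [hℓeq]
        unfold ptForm₁ ptForm₂
        have := ((((h.hasDerivAt_Y u hu).const_mul (v.1 : ℝ)).sub_const (v.2.2 : ℝ)).sub
          ((h.hasDerivAt_slope u hu).mul (((h.hasDerivAt_X u hu).const_mul (v.1 : ℝ)).sub_const
            (v.2.1 : ℝ)))).const_mul g |>.neg
        exact this.congr_deriv (by ring)) hy (by rw [abs_neg, abs_mul, hg, one_mul]; exact hle)
    rw [hscale _ h₁] at key
    refine (measure_mono ?_).trans key
    rintro x ⟨hx, hlt⟩
    rw [ptHeight, max_lt_iff, div_lt_iff₀ h₁] at hlt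
    exact ⟨hx, by rw [abs_neg, abs_mul, hg, one_mul]; exact hlt.1⟩
  · rw [le_div_iff₀ h₂] at hle
    have key := hℓ.volume_abs_lt_le (e := ε * d₂) (S := ρ * d₂) h.pos h.le (abs_nonneg _)
      (by positivity) (by positivity) hy (by rw [hℓeq, abs_mul, hg, one_mul]; exact hle)
    rw [hscale _ h₂] at key
    refine (measure_mono ?_).trans (key.trans (ENNReal.ofReal_le_ofReal ?_))
    · rintro x ⟨hx, hlt⟩
      rw [ptHeight, max_lt_iff, max_lt_iff, div_lt_iff₀ h₂] at hlt
      exact ⟨hx, by rw [hℓeq, abs_mul, hg, one_mul]; exact hlt.2.1⟩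
    · gcongr
      linarith [Real.sqrt_nonneg (sublevelConst m M * (ε / ρ))]
  · have : {x | x ∈ Set.Icc α β ∧ ptHeight X Y σ d₁ d₂ d₃ v x < ε} = ∅ := by
      refine Set.eq_empty_of_forall_notMem fun x hx => ?_
      have := hx.2
      rw [ptHeight, max_lt_iff, max_lt_iff] at this
      linarith [this.2.2]
    rw [this]; simp

theorem PlanarArc.volume_lineHeight_lt_le (h : PlanarArc m M α β X Y σ X' σ') {d₁ d₂ d₃ ε ρ : ℝ}
    (h₂ : 0 < d₂) (h₃ : 0 < d₃) (hε : 0 < ε) (hερ : ε ≤ ρ) (w : ℤ × ℤ × ℤ)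
    (hw : ∃ y ∈ Set.Icc α β, ρ ≤ lineHeight X Y σ d₁ d₂ d₃ w y) :
    volume {x | x ∈ Set.Icc α β ∧ lineHeight X Y σ d₁ d₂ d₃ w x < ε} ≤
      ENNReal.ofReal (2 * √(sublevelConst m M * (ε / ρ)) * (β - α)) := by
  obtain ⟨y, hy, hle⟩ := hw
  have hρ : 0 < ρ := hε.trans_le hερ
  have hαβ : 0 ≤ β - α := by linarith [hy.1, hy.2]
  obtain ⟨g, hg, hgq⟩ := exists_abs_eq_one_mul_eq_abs (w.2.2 : ℝ)
  have hℓ : SlopeBounds m M |(w.2.2 : ℝ)| α β fun u => |(w.2.2 : ℝ)| * σ u + g * w.2.1 :=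
    slopeBounds_affine h.hasDerivAt_slope h.bounds_slope (abs_nonneg _)
  have hℓeq : ∀ u, |(w.2.2 : ℝ)| * σ u + g * w.2.1 = g * lineSlope σ w u := fun u => by
    rw [← hgq, lineSlope]; ring
  have hscale : ∀ d, 0 < d → ε / d / (ρ / d) = ε / ρ := fun d hd => by field_simp
  rw [lineHeight, le_max_iff, le_max_iff] at hle
  rcases hle with hle | hle | hle
  · rw [← div_le_iff₀ h₃] at hle
    have key := hℓ.volume_primitive_lt_le (G := fun u => g * lineForm X Y w u) (h := X')
      (e := ε / d₃) (S := ρ / d₃) h.pos h.le (abs_nonneg _) (by positivity) (by positivity)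
      h.bounds_X (fun u hu => by
        rw [hℓeq]
        unfold lineForm lineSlope
        have := ((((h.hasDerivAt_X u hu).const_mul (w.2.1 : ℝ)).const_add (w.1 : ℝ)).add
          ((h.hasDerivAt_Y u hu).const_mul (w.2.2 : ℝ))).const_mul g
        exact this.congr_deriv (by ring)) hy (by rw [abs_mul, hg, one_mul]; exact hle)
    rw [hscale _ h₃] at key
    refine (measure_mono ?_).trans key
    rintro x ⟨hx, hlt⟩
    rw [lineHeight, max_lt_iff, ← lt_div_iff₀ h₃] at hlt
    exact ⟨hx, by rw [abs_mul, hg, one_mul]; exact hlt.1⟩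
  · rw [← div_le_iff₀ h₂] at hle
    have key := hℓ.volume_abs_lt_le (e := ε / d₂) (S := ρ / d₂) h.pos h.le (abs_nonneg _)
      (by positivity) (by positivity) hy (by rw [hℓeq, abs_mul, hg, one_mul]; exact hle)
    rw [hscale _ h₂] at key
    refine (measure_mono ?_).trans (key.trans (ENNReal.ofReal_le_ofReal ?_))
    · rintro x ⟨hx, hlt⟩
      rw [lineHeight, max_lt_iff, max_lt_iff, ← lt_div_iff₀ h₂] at hlt
      exact ⟨hx, by rw [hℓeq, abs_mul, hg, one_mul]; exact hlt.2.1⟩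
    · gcongr
      linarith [Real.sqrt_nonneg (sublevelConst m M * (ε / ρ))]
  · have : {x | x ∈ Set.Icc α β ∧ lineHeight X Y σ d₁ d₂ d₃ w x < ε} = ∅ := by
      refine Set.eq_empty_of_forall_notMem fun x hx => ?_
      have := hx.2
      rw [lineHeight, max_lt_iff, max_lt_iff] at this
      linarith [this.2.2]
    rw [this]; simp

end Good

section IntegerVectors

/-- The dot product on `ℤ³`. -/
def dot3 (v w : ℤ × ℤ × ℤ) : ℤ := v.1 * w.1 + v.2.1 * w.2.1 + v.2.2 * w.2.2

/-- The cross product on `ℤ³`. -/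
def cross3 (v w : ℤ × ℤ × ℤ) : ℤ × ℤ × ℤ :=
  (v.2.1 * w.2.2 - v.2.2 * w.2.1, v.2.2 * w.1 - v.1 * w.2.2, v.1 * w.2.1 - v.2.1 * w.1)

/-- Primitive vectors of `ℤ³`. -/
def IsPrim (v : ℤ × ℤ × ℤ) : Prop := ∃ x, dot3 x v = 1

theorem IsPrim.ne_zero {v : ℤ × ℤ × ℤ} (h : IsPrim v) : v ≠ 0 := by
  rintro rfl
  obtain ⟨x, hx⟩ := h
  simp [dot3] at hx

theorem exists_isPrim_smul_eq {v : ℤ × ℤ × ℤ} (hv : v ≠ 0) :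
    ∃ k : ℤ, k ≠ 0 ∧ ∃ v', IsPrim v' ∧ v = k • v' := by
  obtain ⟨q, p, r⟩ := v
  set h : ℤ := (Int.gcd p r : ℤ) with hh
  set g : ℤ := (Int.gcd q h : ℤ) with hg
  have hg0 : g ≠ 0 := by
    intro h0
    rw [hg, Int.natCast_eq_zero, Int.gcd_eq_zero_iff, hh, Int.natCast_eq_zero,
      Int.gcd_eq_zero_iff] at h0
    exact hv (by simp [h0.1, h0.2.1, h0.2.2])
  have d1 : g ∣ q := Int.gcd_dvd_left ..
  have d2 : g ∣ h := Int.gcd_dvd_right ..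
  obtain ⟨q', hq⟩ := d1
  obtain ⟨p', hp⟩ := d2.trans (Int.gcd_dvd_left p r)
  obtain ⟨r', hr⟩ := d2.trans (Int.gcd_dvd_right p r)
  have b1 : h = p * Int.gcdA p r + r * Int.gcdB p r := Int.gcd_eq_gcd_ab p r
  have b2 : g = q * Int.gcdA q h + h * Int.gcdB q h := Int.gcd_eq_gcd_ab q h
  refine ⟨g, hg0, (q', p', r'), ⟨(Int.gcdA q h, Int.gcdA p r * Int.gcdB q h,
    Int.gcdB p r * Int.gcdB q h), ?_⟩, by simp [hq, hp, hr]⟩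
  apply mul_left_cancel₀ hg0
  simp only [dot3]
  generalize Int.gcdA q h = A at *
  generalize Int.gcdB q h = B at *
  generalize Int.gcdA p r = A' at *
  generalize Int.gcdB p r = B' at *
  generalize g = g at *
  linear_combination -b2 - A * hq - B * A' * hp - B * B' * hr - B * b1

theorem IsPrim.eq_smul_of_cross3_eq_zero {v u : ℤ × ℤ × ℤ} (hv : IsPrim v)
    (h : cross3 v u = 0) : ∃ k : ℤ, u = k • v := by
  obtain ⟨⟨x, y, z⟩, hx⟩ := hv
  obtain ⟨q, p, r⟩ := v
  obtain ⟨q', p', r'⟩ := u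
  simp only [cross3, Prod.mk_eq_zero, dot3] at h hx
  obtain ⟨h1, h2, h3⟩ := h
  refine ⟨x * q' + y * p' + z * r', ?_⟩
  simp only [Prod.smul_mk, smul_eq_mul, Prod.mk.injEq]
  refine ⟨?_, ?_, ?_⟩
  · linear_combination -q' * hx + z * h2 - y * h3
  · linear_combination -p' * hx - z * h1 + x * h3
  · linear_combination -r' * hx + y * h1 - x * h2

theorem dot3_cross3_left (v w : ℤ × ℤ × ℤ) : dot3 v (cross3 v w) = 0 := by
  simp only [dot3, cross3]; ring

theorem dot3_smul (v w : ℤ × ℤ × ℤ) (k : ℤ) : dot3 v (k • w) = k * dot3 v w := by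
  simp only [dot3, Prod.smul_fst, Prod.smul_snd, smul_eq_mul]; ring

theorem dot3_smul_left (v w : ℤ × ℤ × ℤ) (k : ℤ) : dot3 (k • v) w = k * dot3 v w := by
  simp only [dot3, Prod.smul_fst, Prod.smul_snd, smul_eq_mul]; ring

/-- A vector orthogonal to two others is proportional to their cross product, up to a factor. -/
theorem IsPrim.cross3_eq_smul {w v u : ℤ × ℤ × ℤ} (hw : IsPrim w) (hv : dot3 v w = 0)
    (hu : dot3 u w = 0) : ∃ k : ℤ, cross3 v u = k • w := by
  apply hw.eq_smul_of_cross3_eq_zero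
  simp only [dot3] at hv hu
  simp only [cross3, Prod.mk_eq_zero]
  refine ⟨?_, ?_, ?_⟩
  · linear_combination v.1 * hu - u.1 * hv
  · linear_combination v.2.1 * hu - u.2.1 * hv
  · linear_combination v.2.2 * hu - u.2.2 * hv

end IntegerVectors

section Heights

variable (X Y σ : ℝ → ℝ) {d₁ d₂ d₃ : ℝ}

theorem ptHeight_smul (v : ℤ × ℤ × ℤ) (k : ℤ) (t : ℝ) :
    ptHeight X Y σ d₁ d₂ d₃ (k • v) t = |(k : ℝ)| * ptHeight X Y σ d₁ d₂ d₃ v t := by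
  have e1 : ptForm₁ X Y σ (k • v) t = k * ptForm₁ X Y σ v t := by
    simp only [ptForm₁, Prod.smul_fst, Prod.smul_snd, smul_eq_mul]; push_cast; ring
  have e2 : ptForm₂ X (k • v) t = k * ptForm₂ X v t := by
    simp only [ptForm₂, Prod.smul_fst, Prod.smul_snd, smul_eq_mul]; push_cast; ring
  have e3 : (((k • v).1 : ℤ) : ℝ) = k * v.1 := by
    simp only [Prod.smul_fst, smul_eq_mul]; push_cast; ring
  simp only [ptHeight, e1, e2, e3, abs_mul, mul_div_assoc, mul_max_of_nonneg _ _ (abs_nonneg (k : ℝ))]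

theorem lineHeight_smul (w : ℤ × ℤ × ℤ) (k : ℤ) (t : ℝ) :
    lineHeight X Y σ d₁ d₂ d₃ (k • w) t = |(k : ℝ)| * lineHeight X Y σ d₁ d₂ d₃ w t := by
  have e1 : lineForm X Y (k • w) t = k * lineForm X Y w t := by
    simp only [lineForm, Prod.smul_fst, Prod.smul_snd, smul_eq_mul]; push_cast; ring
  have e2 : lineSlope σ (k • w) t = k * lineSlope σ w t := by
    simp only [lineSlope, Prod.smul_fst, Prod.smul_snd, smul_eq_mul]; push_cast; ring
  have e3 : (((k • w).2.2 : ℤ) : ℝ) = k * w.2.2 := by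
    simp only [Prod.smul_snd, smul_eq_mul]; push_cast; ring
  simp only [lineHeight, e1, e2, e3, abs_mul, mul_assoc, mul_max_of_nonneg _ _ (abs_nonneg (k : ℝ))]

variable {X Y σ}

theorem ptHeight_nonneg (h₃ : 0 < d₃) (v : ℤ × ℤ × ℤ) (t : ℝ) :
    0 ≤ ptHeight X Y σ d₁ d₂ d₃ v t :=
  le_max_of_le_right (le_max_of_le_right (by positivity))

theorem lineHeight_nonneg (h₁ : 0 < d₁) (w : ℤ × ℤ × ℤ) (t : ℝ) :
    0 ≤ lineHeight X Y σ d₁ d₂ d₃ w t :=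
  le_max_of_le_right (le_max_of_le_right (by positivity))

theorem one_le_abs_intCast {k : ℤ} (hk : k ≠ 0) : 1 ≤ |(k : ℝ)| := by
  exact_mod_cast Int.one_le_abs hk

theorem ptHeight_le_smul (h₃ : 0 < d₃) {k : ℤ} (hk : k ≠ 0) (v : ℤ × ℤ × ℤ) (t : ℝ) :
    ptHeight X Y σ d₁ d₂ d₃ v t ≤ ptHeight X Y σ d₁ d₂ d₃ (k • v) t := by
  rw [ptHeight_smul]
  exact le_mul_of_one_le_left (ptHeight_nonneg h₃ v t) (one_le_abs_intCast hk)

theorem lineHeight_le_smul (h₁ : 0 < d₁) {k : ℤ} (hk : k ≠ 0) (w : ℤ × ℤ × ℤ) (t : ℝ) :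
    lineHeight X Y σ d₁ d₂ d₃ w t ≤ lineHeight X Y σ d₁ d₂ d₃ (k • w) t := by
  rw [lineHeight_smul]
  exact le_mul_of_one_le_left (lineHeight_nonneg h₁ w t) (one_le_abs_intCast hk)

theorem abs_le_ptHeight (h₁ : 0 < d₁) (h₂ : 0 < d₂) (h₃ : 0 < d₃) (v : ℤ × ℤ × ℤ) (t : ℝ) :
    |ptForm₁ X Y σ v t| ≤ d₁ * ptHeight X Y σ d₁ d₂ d₃ v t ∧
    |ptForm₂ X v t| ≤ d₂ * ptHeight X Y σ d₁ d₂ d₃ v t ∧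
    |(v.1 : ℝ)| ≤ d₃ * ptHeight X Y σ d₁ d₂ d₃ v t := by
  simp only [← div_le_iff₀' h₁, ← div_le_iff₀' h₂, ← div_le_iff₀' h₃, ptHeight]
  exact ⟨le_max_left _ _, le_max_of_le_right (le_max_left _ _),
    le_max_of_le_right (le_max_right _ _)⟩

theorem abs_mul_le_lineHeight (w : ℤ × ℤ × ℤ) (t : ℝ) :
    |lineForm X Y w t| * d₃ ≤ lineHeight X Y σ d₁ d₂ d₃ w t ∧
    |lineSlope σ w t| * d₂ ≤ lineHeight X Y σ d₁ d₂ d₃ w t ∧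
    |(w.2.2 : ℝ)| * d₁ ≤ lineHeight X Y σ d₁ d₂ d₃ w t :=
  ⟨le_max_left _ _, le_max_of_le_right (le_max_left _ _),
    le_max_of_le_right (le_max_right _ _)⟩

theorem abs_sub_mul_le {a b a' b' A B A' B' : ℝ} (ha : |a| ≤ A) (hb : |b| ≤ B) (ha' : |a'| ≤ A')
    (hb' : |b'| ≤ B') : |a * b' - b * a'| ≤ A * B' + B * A' := by
  calc |a * b' - b * a'| ≤ |a * b'| + |b * a'| := abs_sub _ _
    _ = |a| * |b'| + |b| * |a'| := by rw [abs_mul, abs_mul]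
    _ ≤ _ := by
      have := (abs_nonneg a).trans ha
      have := (abs_nonneg b).trans hb
      gcongr

theorem lineHeight_cross3_le (h₁ : 0 < d₁) (h₂ : 0 < d₂) (h₃ : 0 < d₃) (hd : d₁ * d₂ * d₃ = 1)
    (v v' : ℤ × ℤ × ℤ) (t : ℝ) :
    lineHeight X Y σ d₁ d₂ d₃ (cross3 v v') t ≤
      2 * (ptHeight X Y σ d₁ d₂ d₃ v t * ptHeight X Y σ d₁ d₂ d₃ v' t) := by
  obtain ⟨a1, a2, a3⟩ := abs_le_ptHeight (X := X) (Y := Y) (σ := σ) h₁ h₂ h₃ v t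
  obtain ⟨b1, b2, b3⟩ := abs_le_ptHeight (X := X) (Y := Y) (σ := σ) h₁ h₂ h₃ v' t
  have e1 : lineForm X Y (cross3 v v') t =
      ptForm₂ X v t * ptForm₁ X Y σ v' t - ptForm₁ X Y σ v t * ptForm₂ X v' t := by
    simp only [lineForm, cross3, ptForm₁, ptForm₂]; push_cast; ring
  have e2 : lineSlope σ (cross3 v v') t =
      (v.1 : ℝ) * ptForm₁ X Y σ v' t - ptForm₁ X Y σ v t * v'.1 := by
    simp only [lineSlope, cross3, ptForm₁]; push_cast; ring
  have e3 : (((cross3 v v').2.2 : ℤ) : ℝ) = ptForm₂ X v t * v'.1 - (v.1 : ℝ) * ptForm₂ X v' t := by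
    simp only [cross3, ptForm₂]; push_cast; ring
  have f1 := abs_sub_mul_le a2 a1 b2 b1
  have f2 := abs_sub_mul_le a3 a1 b3 b1
  have f3 := abs_sub_mul_le a2 a3 b2 b3
  rw [← e1] at f1
  rw [← e2] at f2
  rw [← e3] at f3
  set P := ptHeight X Y σ d₁ d₂ d₃ v t
  set P' := ptHeight X Y σ d₁ d₂ d₃ v' t
  refine max_le ?_ (max_le ?_ ?_)
  · calc _ ≤ _ := mul_le_mul_of_nonneg_right f1 h₃.le
      _ = _ := by linear_combination 2 * P * P' * hd
  · calc _ ≤ _ := mul_le_mul_of_nonneg_right f2 h₂.le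
      _ = _ := by linear_combination 2 * P * P' * hd
  · calc _ ≤ _ := mul_le_mul_of_nonneg_right f3 h₁.le
      _ = _ := by linear_combination 2 * P * P' * hd

theorem one_le_lineHeight_mul_ptHeight (h₁ : 0 < d₁) (h₂ : 0 < d₂) (h₃ : 0 < d₃)
    {v w : ℤ × ℤ × ℤ} (h : dot3 v w ≠ 0) (t : ℝ) :
    1 ≤ 3 * (lineHeight X Y σ d₁ d₂ d₃ w t * ptHeight X Y σ d₁ d₂ d₃ v t) := by
  obtain ⟨a1, a2, a3⟩ := abs_le_ptHeight (X := X) (Y := Y) (σ := σ) h₁ h₂ h₃ v t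
  obtain ⟨b1, b2, b3⟩ := abs_mul_le_lineHeight (X := X) (Y := Y) (σ := σ) (d₁ := d₁) (d₂ := d₂)
    (d₃ := d₃) w t
  have h0 := ptHeight_nonneg (X := X) (Y := Y) (σ := σ) (d₁ := d₁) (d₂ := d₂) h₃ v t
  have e : (dot3 v w : ℝ) = lineForm X Y w t * v.1 - lineSlope σ w t * ptForm₂ X v t -
      w.2.2 * ptForm₁ X Y σ v t := by
    simp only [dot3, lineForm, lineSlope, ptForm₁, ptForm₂]; push_cast; ring
  have h1 := one_le_abs_intCast h
  rw [e] at h1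
  set P := ptHeight X Y σ d₁ d₂ d₃ v t
  set L := lineHeight X Y σ d₁ d₂ d₃ w t
  have key : ∀ {x y d : ℝ}, |x| * d ≤ L → |y| ≤ d * P → |x * y| ≤ L * P := by
    intro x y d hx hy
    calc |x * y| = |x| * |y| := abs_mul _ _
      _ ≤ |x| * (d * P) := by gcongr
      _ = |x| * d * P := by ring
      _ ≤ _ := by gcongr
  have k1 := key b1 a3
  have k2 := key b2 a2
  have k3 := key b3 a1
  rw [abs_le] at k1 k2 k3
  have := h1.trans (abs_le.2 ⟨by linarith, by linarith⟩ : _ ≤ 3 * (L * P))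
  exact this

end Heights

section Nondivergence

variable {m M α β : ℝ} {X Y σ X' σ' : ℝ → ℝ} {d₁ d₂ d₃ : ℝ}

theorem PlanarArc.continuousOn_ptHeight (h : PlanarArc m M α β X Y σ X' σ') (v : ℤ × ℤ × ℤ) :
    ContinuousOn (ptHeight X Y σ d₁ d₂ d₃ v) (Set.Icc α β) := by
  have hX : ContinuousOn X (Set.Icc α β) := HasDerivAt.continuousOn h.hasDerivAt_X
  have hY : ContinuousOn Y (Set.Icc α β) := HasDerivAt.continuousOn h.hasDerivAt_Y
  have hσ : ContinuousOn σ (Set.Icc α β) := HasDerivAt.continuousOn h.hasDerivAt_slope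
  unfold ptHeight ptForm₁ ptForm₂
  fun_prop

theorem PlanarArc.continuousOn_lineHeight (h : PlanarArc m M α β X Y σ X' σ') (w : ℤ × ℤ × ℤ) :
    ContinuousOn (lineHeight X Y σ d₁ d₂ d₃ w) (Set.Icc α β) := by
  have hX : ContinuousOn X (Set.Icc α β) := HasDerivAt.continuousOn h.hasDerivAt_X
  have hY : ContinuousOn Y (Set.Icc α β) := HasDerivAt.continuousOn h.hasDerivAt_Y
  have hσ : ContinuousOn σ (Set.Icc α β) := HasDerivAt.continuousOn h.hasDerivAt_slope
  unfold lineHeight lineForm lineSlope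
  fun_prop

theorem SlopeBounds.exists_half_le_abs {l : ℝ} {ℓ : ℝ → ℝ} (h : SlopeBounds m M l α β ℓ)
    (hαβ : α ≤ β) : ∃ y ∈ Set.Icc α β, m * l * (β - α) / 2 ≤ |ℓ y| := by
  have h1 := (h α β le_rfl hαβ le_rfl).1
  by_contra! hcon
  have h2 := abs_lt.1 (hcon α ⟨le_rfl, hαβ⟩)
  have h3 := abs_lt.1 (hcon β ⟨hαβ, le_rfl⟩)
  linarith [h2.1, h3.2]

theorem PlanarArc.exists_le_ptHeight (h : PlanarArc m M α β X Y σ X' σ') (hαβ : α ≤ β)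
    (h₁ : 0 < d₁) (h₂ : 0 < d₂) (h₁' : d₁ ≤ 1) (h₂' : d₂ ≤ 1)
    (hd₂ : d₂ ≤ m * (β - α)) {v : ℤ × ℤ × ℤ} (hv : v ≠ 0) :
    ∃ y ∈ Set.Icc α β, 1 / 3 ≤ ptHeight X Y σ d₁ d₂ d₃ v y := by
  suffices H : ∃ y ∈ Set.Icc α β, d₁ / 3 ≤ |ptForm₁ X Y σ v y| ∨ d₂ / 3 ≤ |ptForm₂ X v y| by
    obtain ⟨y, hy, hle | hle⟩ := H
    · refine ⟨y, hy, le_max_of_le_left ?_⟩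
      rw [le_div_iff₀ h₁]; linarith
    · refine ⟨y, hy, le_max_of_le_right (le_max_of_le_left ?_)⟩
      rw [le_div_iff₀ h₂]; linarith
  by_cases hq : v.1 = 0
  · refine ⟨α, ⟨le_rfl, hαβ⟩, ?_⟩
    by_cases hp : v.2.1 = 0
    · left
      have hr : v.2.2 ≠ 0 := fun hr => hv (by ext <;> simp [hq, hp, hr])
      have := one_le_abs_intCast hr
      simp only [ptForm₁, hq, hp]
      simp only [Int.cast_zero, zero_mul, sub_zero, zero_sub, mul_zero, abs_neg]
      linarith
    · right
      have := one_le_abs_intCast hp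
      simp only [ptForm₂, hq]
      simp only [Int.cast_zero, zero_mul, zero_sub, abs_neg]
      linarith
  · obtain ⟨g, hg, hgq⟩ := exists_abs_eq_one_mul_eq_abs (v.1 : ℝ)
    have hℓ : SlopeBounds m M |(v.1 : ℝ)| α β fun u => |(v.1 : ℝ)| * X u + -(g * v.2.1) :=
      slopeBounds_affine h.hasDerivAt_X h.bounds_X (abs_nonneg _)
    obtain ⟨y, hy, hle⟩ := hℓ.exists_half_le_abs hαβ
    refine ⟨y, hy, Or.inr ?_⟩
    have e : |(v.1 : ℝ)| * X y + -(g * v.2.1) = g * ptForm₂ X v y := by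
      rw [← hgq, ptForm₂]; ring
    rw [e, abs_mul, hg, one_mul] at hle
    refine le_trans ?_ hle
    have h1 := one_le_abs_intCast hq
    have h2 : 0 ≤ m * (β - α) := by linarith
    nlinarith

theorem PlanarArc.exists_le_lineHeight (h : PlanarArc m M α β X Y σ X' σ') (hαβ : α < β)
    (h₃ : 1 ≤ d₃) (hd₃ : 1 ≤ d₃ * (m * (β - α)))
    (hd₃' : 32 ≤ d₃ * (m * (β - α)) ^ 2) {w : ℤ × ℤ × ℤ} (hw : w ≠ 0) :
    ∃ y ∈ Set.Icc α β, 1 / 3 ≤ lineHeight X Y σ d₁ d₂ d₃ w y := by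
  have hm := h.pos
  have hd0 : 0 < d₃ := by linarith
  have hL : 0 < m * (β - α) := mul_pos hm (by linarith)
  suffices H : ∃ y ∈ Set.Icc α β, 1 / 3 ≤ |lineForm X Y w y| * d₃ by
    obtain ⟨y, hy, hle⟩ := H
    exact ⟨y, hy, le_max_of_le_left hle⟩
  by_cases hb : w.2.2 = 0
  · by_cases ha : w.2.1 = 0
    · have hc : w.1 ≠ 0 := fun hc => hw (by ext <;> simp [ha, hb, hc])
      refine ⟨α, ⟨le_rfl, hαβ.le⟩, ?_⟩
      have := one_le_abs_intCast hc
      simp only [lineForm, ha, hb]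
      simp only [Int.cast_zero, zero_mul, add_zero]
      nlinarith
    · obtain ⟨g, hg, hgq⟩ := exists_abs_eq_one_mul_eq_abs (w.2.1 : ℝ)
      have hℓ : SlopeBounds m M |(w.2.1 : ℝ)| α β fun u => |(w.2.1 : ℝ)| * X u + g * w.1 :=
        slopeBounds_affine h.hasDerivAt_X h.bounds_X (abs_nonneg _)
      obtain ⟨y, hy, hle⟩ := hℓ.exists_half_le_abs hαβ.le
      refine ⟨y, hy, ?_⟩
      have e : |(w.2.1 : ℝ)| * X y + g * w.1 = g * lineForm X Y w y := by
        rw [← hgq, lineForm, hb, Int.cast_zero]; ring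
      rw [e, abs_mul, hg, one_mul] at hle
      have h1 := one_le_abs_intCast ha
      have h2 : m * (β - α) / 2 ≤ |lineForm X Y w y| := le_trans (by nlinarith) hle
      nlinarith
  · obtain ⟨g, hg, hgq⟩ := exists_abs_eq_one_mul_eq_abs (w.2.2 : ℝ)
    have h1 := one_le_abs_intCast hb
    have hℓ : SlopeBounds m M |(w.2.2 : ℝ)| α β fun u => |(w.2.2 : ℝ)| * σ u + g * w.2.1 :=
      slopeBounds_affine h.hasDerivAt_slope h.bounds_slope (abs_nonneg _)
    have e : ∀ u, |(w.2.2 : ℝ)| * σ u + g * w.2.1 = g * lineSlope σ w u := fun u => by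
      rw [← hgq, lineSlope]; ring
    simp only [e] at hℓ
    have hF : ∀ u ∈ Set.Icc α β, HasDerivAt (fun u => g * lineForm X Y w u)
        (X' u * (g * lineSlope σ w u)) u := fun u hu => by
      unfold lineForm lineSlope
      have := ((((h.hasDerivAt_X u hu).const_mul (w.2.1 : ℝ)).const_add (w.1 : ℝ)).add
        ((h.hasDerivAt_Y u hu).const_mul (w.2.2 : ℝ))).const_mul g
      exact this.congr_deriv (by ring)
    have habs : ∀ u, |g * lineForm X Y w u| = |lineForm X Y w u| := fun u => by
      rw [abs_mul, hg, one_mul]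
    -- A quarter of the interval on which the derivative is large.
    obtain ⟨a, b, ha, hab, hbβ, hlen, hbig⟩ : ∃ a b, α ≤ a ∧ a < b ∧ b ≤ β ∧ b - a = (β - α) / 4 ∧
        ∀ u, a < u → u < b → m * (β - α) / 4 ≤ |g * lineSlope σ w u| := by
      rcases le_total 0 (g * lineSlope σ w ((α + β) / 2)) with h0 | h0
      · refine ⟨(α + 3 * β) / 4, β, by linarith, by linarith, le_rfl, by ring, fun u hu hu' => ?_⟩
        have := (hℓ ((α + β) / 2) u (by linarith) (by linarith) hu'.le).1
        refine le_trans ?_ (le_abs_self _)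
        have h2 : m * 1 * ((β - α) / 4) ≤ m * |(w.2.2 : ℝ)| * (u - (α + β) / 2) := by
          have : (β - α) / 4 ≤ u - (α + β) / 2 := by linarith
          have : 0 ≤ (β - α) / 4 := by linarith
          gcongr
        linarith
      · refine ⟨α, (3 * α + β) / 4, le_rfl, by linarith, by linarith, by ring, fun u hu hu' => ?_⟩
        have := (hℓ u ((α + β) / 2) hu.le (by linarith) (by linarith)).1
        refine le_trans ?_ (neg_le_abs _)
        have h2 : m * 1 * ((β - α) / 4) ≤ m * |(w.2.2 : ℝ)| * ((α + β) / 2 - u) := by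
          have : (β - α) / 4 ≤ (α + β) / 2 - u := by linarith
          have : 0 ≤ (β - α) / 4 := by linarith
          gcongr
        linarith
    obtain ⟨ξ, hξ1, hξ2, hξ⟩ := exists_slope_eq (f' := fun u => X' u * (g * lineSlope σ w u)) hF ha
      hab hbβ
    have hge : (m * (β - α)) ^ 2 / 16 ≤ |g * lineForm X Y w b - g * lineForm X Y w a| := by
      rw [hξ, abs_mul, abs_mul, hlen]
      have h2 := hbig ξ hξ1 hξ2
      have h3 : m ≤ |X' ξ| := (h.bounds_X ξ ⟨by linarith, by linarith⟩).1.trans (le_abs_self _)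
      have h4 : |(β - α) / 4| = (β - α) / 4 := abs_of_pos (by linarith)
      rw [h4]
      have h5 : 0 ≤ (β - α) / 4 := by linarith
      calc (m * (β - α)) ^ 2 / 16 = m * (m * (β - α) / 4) * ((β - α) / 4) := by ring
        _ ≤ _ := by gcongr
    have h6 : |g * lineForm X Y w b - g * lineForm X Y w a| ≤
        |lineForm X Y w b| + |lineForm X Y w a| := by
      rw [← habs b, ← habs a]; exact abs_sub _ _
    by_contra! hcon
    have h7 := hcon b ⟨by linarith, hbβ⟩
    have h8 := hcon a ⟨ha, by linarith⟩
    have h9 : (m * (β - α)) ^ 2 / 16 * d₃ ≤ (|lineForm X Y w b| + |lineForm X Y w a|) * d₃ := by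
      gcongr; exact hge.trans h6
    linarith

/-- **Nondivergence on a planar arc**: most points of the arc admit no nonzero integer vector of
height less than `ε`. -/
theorem PlanarArc.volume_exists_ptHeight_lt_le (h : PlanarArc m M α β X Y σ X' σ') (hαβ : α < β)
    (h₁ : 0 < d₁) (h₂ : 0 < d₂) (hd : d₁ * d₂ * d₃ = 1) (h₁' : d₁ ≤ 1) (h₂' : d₂ ≤ 1)
    (h₃' : 1 ≤ d₃) (hd₂ : d₂ ≤ m * (β - α)) (hd₃ : 1 ≤ d₃ * (m * (β - α)))
    (hd₃' : 32 ≤ d₃ * (m * (β - α)) ^ 2) {ε : ℝ} (hε : 0 < ε) (hε' : ε ≤ 1 / 3) :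
    volume {x | x ∈ Set.Icc α β ∧ ∃ u : ℤ × ℤ × ℤ, u ≠ 0 ∧ ptHeight X Y σ d₁ d₂ d₃ u x < ε} ≤
      ENNReal.ofReal (2 * Besicovitch.multiplicity ℝ * ((1 + 2 * Besicovitch.multiplicity ℝ) *
        (2 * √(sublevelConst m M * (ε / (1 / 3))))) * (β - α)) := by
  have h₃ : 0 < d₃ := by linarith
  set V := {v : ℤ × ℤ × ℤ // IsPrim v}
  let φ : V ⊕ V → ℝ → ℝ := Sum.elim (fun v => ptHeight X Y σ d₁ d₂ d₃ v.1)
    (fun w => lineHeight X Y σ d₁ d₂ d₃ w.1)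
  let R : V ⊕ V → V ⊕ V → Prop := fun i j => match i, j with
    | Sum.inl v, Sum.inr w => dot3 v.1 w.1 = 0
    | Sum.inr w, Sum.inl v => dot3 v.1 w.1 = 0
    | _, _ => False
  have hflag : ∀ x (u : ℤ × ℤ × ℤ) (v w : V), u ≠ 0 → ptHeight X Y σ d₁ d₂ d₃ u x < ε →
      dot3 v.1 w.1 = 0 → ptHeight X Y σ d₁ d₂ d₃ v.1 x < 1 / 3 →
      lineHeight X Y σ d₁ d₂ d₃ w.1 x < 1 / 3 →
      ptHeight X Y σ d₁ d₂ d₃ v.1 x < ε ∨ lineHeight X Y σ d₁ d₂ d₃ w.1 x < ε := by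
    intro x u v w hu hux hvw hv hw
    have hP := ptHeight_nonneg (X := X) (Y := Y) (σ := σ) (d₁ := d₁) (d₂ := d₂) h₃ u x
    have hP' := ptHeight_nonneg (X := X) (Y := Y) (σ := σ) (d₁ := d₁) (d₂ := d₂) h₃ v.1 x
    have hL := lineHeight_nonneg (X := X) (Y := Y) (σ := σ) (d₂ := d₂) (d₃ := d₃) h₁ w.1 x
    have huw : dot3 u w.1 = 0 := by
      by_contra hne
      have := one_le_lineHeight_mul_ptHeight (X := X) (Y := Y) (σ := σ) h₁ h₂ h₃ hne x
      nlinarith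
    obtain ⟨k, hk⟩ := w.2.cross3_eq_smul hvw huw
    by_cases hk0 : k = 0
    · left
      rw [hk0, zero_smul] at hk
      obtain ⟨j, rfl⟩ := v.2.eq_smul_of_cross3_eq_zero hk
      have hj : j ≠ 0 := by rintro rfl; simp at hu
      exact (ptHeight_le_smul h₃ hj v.1 x).trans_lt hux
    · right
      have := lineHeight_cross3_le (X := X) (Y := Y) (σ := σ) h₁ h₂ h₃ hd v.1 u x
      rw [hk] at this
      have := (lineHeight_le_smul (X := X) (Y := Y) (σ := σ) (d₂ := d₂) (d₃ := d₃) h₁ hk0 w.1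
        x).trans this
      nlinarith
  refine volume_le_of_flags φ R α β (1 / 3) ε _ (by positivity) ?_ ?_ ?_ _ (fun x hx => hx.1)
    ?_ ?_ ?_
  · rintro (v | w)
    · exact h.continuousOn_ptHeight v.1
    · exact h.continuousOn_lineHeight w.1
  · rintro (v | w)
    · exact h.exists_le_ptHeight hαβ.le h₁ h₂ h₁' h₂' hd₂ v.2.ne_zero
    · exact h.exists_le_lineHeight hαβ h₃' hd₃ hd₃' w.2.ne_zero
  · rintro (v | w) s' t' hs - ht hy
    · exact (h.mono hs ht).volume_ptHeight_lt_le h₁ h₂ hε hε' v.1 hy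
    · exact (h.mono hs ht).volume_lineHeight_lt_le h₂ h₃ hε hε' w.1 hy
  · rintro x ⟨-, u, hu, hux⟩
    obtain ⟨k, hk, v, hv, rfl⟩ := exists_isPrim_smul_eq hu
    exact ⟨Sum.inl ⟨v, hv⟩, ((ptHeight_le_smul h₃ hk v x).trans_lt hux).trans_le hε'⟩
  · rintro x ⟨-, u, hu, hux⟩ (v | w) hi
    · have hP := ptHeight_nonneg (X := X) (Y := Y) (σ := σ) (d₁ := d₁) (d₂ := d₂) h₃ u x
      have hP' := ptHeight_nonneg (X := X) (Y := Y) (σ := σ) (d₁ := d₁) (d₂ := d₂) h₃ v.1 x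
      replace hi : ptHeight X Y σ d₁ d₂ d₃ v.1 x < 1 / 3 := hi
      by_cases hc : cross3 v.1 u = 0
      · left
        obtain ⟨j, rfl⟩ := v.2.eq_smul_of_cross3_eq_zero hc
        have hj : j ≠ 0 := by rintro rfl; simp at hu
        exact (ptHeight_le_smul h₃ hj v.1 x).trans_lt hux
      · right
        obtain ⟨k, hk, w, hw, he⟩ := exists_isPrim_smul_eq hc
        refine ⟨Sum.inr ⟨w, hw⟩, ?_, ?_⟩
        · have := dot3_cross3_left v.1 u
          rw [he, dot3_smul] at this
          exact (mul_eq_zero.1 this).resolve_left hk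
        · have := lineHeight_cross3_le (X := X) (Y := Y) (σ := σ) h₁ h₂ h₃ hd v.1 u x
          rw [he] at this
          have := (lineHeight_le_smul (X := X) (Y := Y) (σ := σ) (d₂ := d₂) (d₃ := d₃) h₁ hk w
            x).trans this
          change lineHeight X Y σ d₁ d₂ d₃ w x < 1 / 3
          nlinarith
    · right
      replace hi : lineHeight X Y σ d₁ d₂ d₃ w.1 x < 1 / 3 := hi
      have hP := ptHeight_nonneg (X := X) (Y := Y) (σ := σ) (d₁ := d₁) (d₂ := d₂) h₃ u x
      have hL := lineHeight_nonneg (X := X) (Y := Y) (σ := σ) (d₂ := d₂) (d₃ := d₃) h₁ w.1 x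
      obtain ⟨k, hk, v, hv, rfl⟩ := exists_isPrim_smul_eq hu
      refine ⟨Sum.inl ⟨v, hv⟩, ?_, ((ptHeight_le_smul h₃ hk v x).trans_lt hux).trans_le hε'⟩
      change dot3 v w.1 = 0
      by_contra hne
      have hne' : dot3 (k • v) w.1 ≠ 0 := by
        rw [dot3_smul_left]; exact mul_ne_zero hk hne
      have := one_le_lineHeight_mul_ptHeight (X := X) (Y := Y) (σ := σ) h₁ h₂ h₃ hne' x
      nlinarith
  · rintro x ⟨-, u, hu, hux⟩ (v | w) (v' | w') hR hi hj
    · exact hR.elim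
    · exact hflag x u v w' hu hux hR hi hj
    · exact (hflag x u v' w hu hux hR hj hi).symm
    · exact hR.elim

end Nondivergence

section Ubiquity

/-- A Dirichlet-type theorem for two linear forms in `(q, p, r)`. -/
theorem exists_near_rational (x y s : ℝ) {Q D : ℕ} (hD : 0 < D) (hDQ : D ≤ Q) :
    ∃ q : ℕ, 0 < q ∧ q ≤ Q ∧ ∃ p r : ℤ, |q * x - p| < 2 * D / Q ∧
      |q * y - r - s * (q * x - p)| < 1 / D := by
  set A : ℕ := Q / D with hA
  have hA0 : 0 < A := Nat.div_pos hDQ hD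
  have hAD : A * D ≤ Q := Nat.div_mul_le_self Q D
  have hQA : Q < (A + 1) * D := by
    have := Nat.lt_mul_div_succ Q hD
    rw [mul_comm]; exact this
  let u : ℕ → ℝ := fun q => Int.fract (q * x)
  let w : ℕ → ℝ := fun q => Int.fract (q * y - s * u q)
  have hmaps : ∀ q ∈ Finset.range (Q + 1), (⌊A * u q⌋, ⌊D * w q⌋) ∈
      (Finset.Ico (0 : ℤ) A) ×ˢ (Finset.Ico (0 : ℤ) D) := by
    have key : ∀ {v : ℝ} {N : ℕ}, 0 < N → 0 ≤ v → v < 1 → ⌊N * v⌋ ∈ Finset.Ico (0 : ℤ) N := by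
      intro v N hN h0 h1
      have hN' : (0 : ℝ) < N := by exact_mod_cast hN
      rw [Finset.mem_Ico]
      refine ⟨Int.floor_nonneg.2 (by positivity), Int.floor_lt.2 ?_⟩
      push_cast
      nlinarith
    intro q _
    exact Finset.mem_product.2 ⟨key hA0 (Int.fract_nonneg _) (Int.fract_lt_one _),
      key hD (Int.fract_nonneg _) (Int.fract_lt_one _)⟩
  have hcard : ((Finset.Ico (0 : ℤ) A) ×ˢ (Finset.Ico (0 : ℤ) D)).card <
      (Finset.range (Q + 1)).card := by
    simp only [Finset.card_product, Int.card_Ico, sub_zero, Int.toNat_natCast, Finset.card_range]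
    omega
  obtain ⟨a, ha, b, hb, hne, heq⟩ := Finset.exists_ne_map_eq_of_card_lt_of_maps_to hcard hmaps
  have close : ∀ {v v' : ℝ} {N : ℕ}, 0 < N → ⌊N * v⌋ = ⌊N * v'⌋ → |v - v'| < 1 / N := by
    intro v v' N hN h
    have hN' : (0 : ℝ) < N := by exact_mod_cast hN
    have := Int.abs_sub_lt_one_of_floor_eq_floor h
    rw [← mul_sub, abs_mul, abs_of_pos hN'] at this
    rw [lt_div_iff₀ hN', mul_comm]; exact this
  wlog hlt : a < b generalizing a b
  · exact this b hb a ha hne.symm heq.symm (lt_of_le_of_ne (not_lt.1 hlt) hne.symm)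
  simp only [Prod.mk.injEq] at heq
  have h1 := close hA0 heq.1.symm
  have h2 := close hD heq.2.symm
  refine ⟨b - a, by omega, by have := Finset.mem_range.1 hb; omega, ⌊b * x⌋ - ⌊a * x⌋,
    ⌊b * y - s * u b⌋ - ⌊a * y - s * u a⌋, ?_, ?_⟩
  · have e : ((b - a : ℕ) : ℝ) * x - ((⌊b * x⌋ - ⌊a * x⌋ : ℤ) : ℝ) = u b - u a := by
      simp only [u, Int.fract]
      rw [Nat.cast_sub hlt.le]; push_cast; ring
    rw [e]
    refine h1.trans_le ?_
    have hQ' : (0 : ℝ) < Q := by exact_mod_cast (hD.trans_le hDQ)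
    have hA' : (1 : ℝ) ≤ A := by exact_mod_cast hA0
    have hD' : (0 : ℝ) < D := by exact_mod_cast hD
    rw [div_le_div_iff₀ (by linarith) hQ']
    have : (Q : ℝ) < (A + 1) * D := by exact_mod_cast hQA
    nlinarith
  · have e : ((b - a : ℕ) : ℝ) * y - ((⌊b * y - s * u b⌋ - ⌊a * y - s * u a⌋ : ℤ) : ℝ) -
        s * (((b - a : ℕ) : ℝ) * x - ((⌊b * x⌋ - ⌊a * x⌋ : ℤ) : ℝ)) = w b - w a := by
      simp only [w, u, Int.fract]
      rw [Nat.cast_sub hlt.le]; push_cast; ring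
    rw [e]
    exact h2

variable {m M α β : ℝ} {X Y σ X' σ' : ℝ → ℝ}

theorem exists_nondivergence_const {m M : ℝ} : ∃ ε : ℝ, 0 < ε ∧ ε ≤ 1 / 3 ∧
      2 * (Besicovitch.multiplicity ℝ : ℝ) * ((1 + 2 * Besicovitch.multiplicity ℝ) *
        (2 * √(sublevelConst m M * (ε / (1 / 3))))) ≤ 1 / 2 := by
  set B : ℝ := (Besicovitch.multiplicity ℝ : ℝ) with hB
  have hB0 : 0 ≤ B := by positivity
  have hS : 0 < sublevelConst m M := by unfold sublevelConst; positivity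
  set K : ℝ := 8 * B * (1 + 2 * B) + 1 with hK
  have hK0 : 0 < K := by positivity
  refine ⟨min (1 / 3) (1 / (3 * sublevelConst m M * K ^ 2)), by positivity, min_le_left _ _, ?_⟩
  have h1 : √(sublevelConst m M * (min (1 / 3) (1 / (3 * sublevelConst m M * K ^ 2)) / (1 / 3))) ≤
      1 / K := by
    refine Real.sqrt_le_iff.2 ⟨by positivity, ?_⟩
    calc _ ≤ sublevelConst m M * (1 / (3 * sublevelConst m M * K ^ 2) / (1 / 3)) := by
          gcongr; exact min_le_right _ _
      _ = _ := by field_simp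
  have h2 : 1 / K * K = 1 := by field_simp
  have h3 : 0 < 1 / K := by positivity
  calc _ ≤ 2 * B * ((1 + 2 * B) * (2 * (1 / K))) := by gcongr
    _ ≤ 1 / 2 := by nlinarith

/-- Rational points near the arc: `x` is good at scale `(Q, D)` if some rational point with
denominator between `κ Q` and `Q` is close to the arc near `x`. -/
def IsNear (X Y σ : ℝ → ℝ) (κ : ℝ) (Q D : ℕ) (x : ℝ) : Prop :=
  ∃ q : ℕ, 0 < q ∧ q ≤ Q ∧ κ * Q ≤ q ∧ ∃ p r : ℤ, |q * X x - p| < 2 * D / Q ∧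
    |q * Y x - r - σ x * (q * X x - p)| < 1 / D

theorem PlanarArc.half_le_volume_isNear (h : PlanarArc m M α β X Y σ X' σ') (hαβ : α < β)
    {ε : ℝ} (hε : 0 < ε) (hε' : ε ≤ 1 / 3)
    (hεC : 2 * (Besicovitch.multiplicity ℝ : ℝ) * ((1 + 2 * Besicovitch.multiplicity ℝ) *
        (2 * √(sublevelConst m M * (ε / (1 / 3))))) ≤ 1 / 2)
    {Q D : ℕ} (hD : 1 ≤ D * ε) (hDQ : 2 * D ≤ Q * ε) (hDQ' : 2 * D ≤ Q * ε * (m * (β - α)))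
    (hQ : 64 ≤ ε ^ 2 * Q) (hQ₁ : 64 ≤ ε ^ 2 * Q * (m * (β - α)))
    (hQ₂ : 64 ≤ ε ^ 2 * Q * (m * (β - α)) ^ 2) :
    ENNReal.ofReal ((β - α) / 2) ≤
      volume {x | x ∈ Set.Icc α β ∧ IsNear X Y σ (ε ^ 3 / 2) Q D x} := by
  have hD0 : (0 : ℝ) < D := by
    by_contra! hc
    nlinarith
  have hQ0 : (0 : ℝ) < Q := by
    by_contra! hc
    nlinarith [sq_nonneg ε]
  have hDn : 0 < D := by exact_mod_cast hD0
  have hDQn : D ≤ Q := by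
    have : (D : ℝ) ≤ Q := by nlinarith
    exact_mod_cast this
  have hE := h.volume_exists_ptHeight_lt_le hαβ (d₁ := 1 / (D * ε)) (d₂ := 2 * D / (Q * ε))
    (d₃ := ε ^ 2 * Q / 2) (by positivity) (by positivity) (by field_simp)
    ((div_le_one (by positivity)).2 hD) ((div_le_one (by positivity)).2 hDQ) (by linarith)
    ((div_le_iff₀ (by positivity)).2 (by linarith)) (by linarith) (by linarith) hε hε'
  set E := {x | x ∈ Set.Icc α β ∧ ∃ u : ℤ × ℤ × ℤ, u ≠ 0 ∧
    ptHeight X Y σ (1 / (D * ε)) (2 * D / (Q * ε)) (ε ^ 2 * Q / 2) u x < ε} with hEdef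
  set G := {x | x ∈ Set.Icc α β ∧ IsNear X Y σ (ε ^ 3 / 2) Q D x} with hGdef
  have hsub : Set.Icc α β ⊆ G ∪ E := by
    intro x hx
    by_contra hcon
    rw [Set.mem_union, not_or] at hcon
    obtain ⟨q, hq, hqQ, p, r, h1, h2⟩ := exists_near_rational (X x) (Y x) (σ x) hDn hDQn
    have hq' : (0 : ℝ) < q := by exact_mod_cast hq
    by_cases hk : ε ^ 3 / 2 * Q ≤ q
    · exact hcon.1 ⟨hx, q, hq, hqQ, hk, p, r, h1, h2⟩
    · refine hcon.2 ⟨hx, (q, p, r), by simp [hq.ne'], ?_⟩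
      refine max_lt ?_ (max_lt ?_ ?_)
      · rw [div_lt_iff₀ (by positivity)]
        refine lt_of_lt_of_eq (b := 1 / (D : ℝ)) ?_ (by field_simp)
        simpa [ptForm₁] using h2
      · rw [div_lt_iff₀ (by positivity)]
        refine lt_of_lt_of_eq (b := 2 * (D : ℝ) / Q) ?_ (by field_simp)
        simpa [ptForm₂] using h1
      · rw [div_lt_iff₀ (by positivity)]
        simp only [Int.cast_natCast, Nat.abs_cast]
        push Not at hk
        linarith
  have hvol : ENNReal.ofReal (β - α) ≤ volume G + ENNReal.ofReal ((β - α) / 2) := by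
    calc ENNReal.ofReal (β - α) = volume (Set.Icc α β) := Real.volume_Icc.symm
      _ ≤ volume (G ∪ E) := measure_mono hsub
      _ ≤ volume G + volume E := measure_union_le _ _
      _ ≤ _ := by
        gcongr
        refine hE.trans (ENNReal.ofReal_le_ofReal ?_)
        have : 0 < β - α := by linarith
        nlinarith
  have e : ENNReal.ofReal (β - α) = ENNReal.ofReal ((β - α) / 2) + ENNReal.ofReal ((β - α) / 2) := by
    rw [← ENNReal.ofReal_add (by linarith) (by linarith)]; congr 1; ring
  rw [e] at hvol
  exact (ENNReal.add_le_add_iff_right ENNReal.ofReal_ne_top).1 hvol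

theorem PlanarArc.abs_X_sub_le (h : PlanarArc m M α β X Y σ X' σ') {x z : ℝ}
    (hx : x ∈ Set.Icc α β) (hz : z ∈ Set.Icc α β) : |X z - X x| ≤ M * |z - x| := by
  have := (convex_Icc α β).norm_image_sub_le_of_norm_hasDerivWithin_le (f := X) (f' := X') (C := M)
    (fun u hu => (h.hasDerivAt_X u hu).hasDerivWithinAt) (fun u hu => by
      have := h.bounds_X u hu
      rw [Real.norm_eq_abs, abs_of_nonneg (by linarith [h.pos])]; exact this.2) hx hz
  simpa using this

theorem PlanarArc.abs_slope_sub_le (h : PlanarArc m M α β X Y σ X' σ') {x z : ℝ}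
    (hx : x ∈ Set.Icc α β) (hz : z ∈ Set.Icc α β) : |σ z - σ x| ≤ M * |z - x| := by
  have := (convex_Icc α β).norm_image_sub_le_of_norm_hasDerivWithin_le (f := σ) (f' := σ') (C := M)
    (fun u hu => (h.hasDerivAt_slope u hu).hasDerivWithinAt) (fun u hu => by
      have := h.bounds_slope u hu
      rw [Real.norm_eq_abs, abs_of_nonneg (by linarith [h.pos])]; exact this.2) hx hz
  simpa using this

/-- Second order Taylor estimate. -/
theorem PlanarArc.abs_taylor_le (h : PlanarArc m M α β X Y σ X' σ') {x z : ℝ}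
    (hx : x ∈ Set.Icc α β) (hz : z ∈ Set.Icc α β) :
    |Y z - Y x - σ x * (X z - X x)| ≤ M ^ 2 * |z - x| ^ 2 := by
  have hM : 0 < M := h.pos.trans_le h.le
  have hsub : Set.uIcc x z ⊆ Set.Icc α β := Set.uIcc_subset_Icc hx hz
  have := (convex_uIcc x z).norm_image_sub_le_of_norm_hasDerivWithin_le
    (f := fun u => Y u - σ x * X u) (f' := fun u => X' u * σ u - σ x * X' u)
    (C := M ^ 2 * |z - x|)
    (fun u hu => ((h.hasDerivAt_Y u (hsub hu)).sub
      ((h.hasDerivAt_X u (hsub hu)).const_mul (σ x))).hasDerivWithinAt) (fun u hu => by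
      have h1 := h.bounds_X u (hsub hu)
      have h2 := h.abs_slope_sub_le hx (hsub hu)
      have h3 : |u - x| ≤ |z - x| := Set.abs_sub_left_of_mem_uIcc hu
      have h4 : X' u * σ u - σ x * X' u = X' u * (σ u - σ x) := by ring
      rw [Real.norm_eq_abs, h4, abs_mul, abs_of_nonneg (by linarith [h.pos])]
      calc X' u * |σ u - σ x| ≤ M * (M * |z - x|) := by
            gcongr
            · exact h1.2
            · exact h2.trans (by gcongr)
        _ = _ := by ring) Set.left_mem_uIcc Set.right_mem_uIcc
  simp only [Real.norm_eq_abs] at this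
  calc _ = |Y z - σ x * X z - (Y x - σ x * X x)| := by congr 1; ring
    _ ≤ _ := this
    _ = _ := by ring

theorem PlanarArc.abs_Y_sub_le (h : PlanarArc m M α β X Y σ X' σ') {x z : ℝ}
    (hx : x ∈ Set.Icc α β) (hz : z ∈ Set.Icc α β) : |Y z - Y x| ≤ M ^ 2 * |z - x| := by
  have := (convex_Icc α β).norm_image_sub_le_of_norm_hasDerivWithin_le (f := Y)
    (f' := fun u => X' u * σ u) (C := M ^ 2)
    (fun u hu => (h.hasDerivAt_Y u hu).hasDerivWithinAt) (fun u hu => by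
      have h1 := h.bounds_X u hu
      have h2 := h.abs_slope_le u hu
      rw [Real.norm_eq_abs, abs_mul, abs_of_nonneg (by linarith [h.pos]), sq]
      have := h.pos
      exact mul_le_mul h1.2 h2 (abs_nonneg _) (by linarith)) hx hz
  simpa using this

/-- A good point is close to a point of the arc whose first coordinate is rational. -/
theorem PlanarArc.exists_eq_of_isNear (h : PlanarArc m M α β X Y σ X' σ') {κ : ℝ} (hκ : 0 < κ)
    {Q D : ℕ} (hQ : 0 < Q) (hD : 0 < D) (hDQ : 4 * M ^ 2 * D ^ 3 ≤ κ ^ 2 * m ^ 2 * Q ^ 3) {x δ : ℝ}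
    (hδ : δ = 2 * D / (κ * m * Q ^ 2)) (hα : α ≤ x - δ) (hβ : x + δ ≤ β)
    (hx : IsNear X Y σ κ Q D x) :
    ∃ z, |z - x| ≤ δ ∧ ∃ q : ℕ, 0 < q ∧ q ≤ Q ∧ κ * Q ≤ q ∧ ∃ p r : ℤ, q * X z = p ∧
      |q * Y z - r| ≤ 2 / D := by
  obtain ⟨q, hq, hqQ, hκq, p, r, h1, h2⟩ := hx
  have hm := h.pos
  have hQ' : (0 : ℝ) < Q := by exact_mod_cast hQ
  have hD' : (0 : ℝ) < D := by exact_mod_cast hD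
  have hq' : (0 : ℝ) < q := by exact_mod_cast hq
  have hqQ' : (q : ℝ) ≤ Q := by exact_mod_cast hqQ
  have hδ0 : 0 < δ := by rw [hδ]; positivity
  have hxI : x ∈ Set.Icc α β := ⟨by linarith, by linarith⟩
  have hstep : 2 * D / Q ≤ q * (m * δ) := by
    have : 2 * D / Q = κ * Q * (m * δ) := by rw [hδ]; field_simp
    rw [this]; gcongr
  have hℓ : SlopeBounds m M 1 α β fun u => 1 * X u + 0 :=
    slopeBounds_affine h.hasDerivAt_X h.bounds_X zero_le_one
  have hlo := (hℓ (x - δ) x hα (by linarith) hxI.2).1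
  have hhi := (hℓ x (x + δ) hxI.1 (by linarith) hβ).1
  simp only [one_mul, add_zero, mul_one] at hlo hhi
  rw [abs_lt] at h1
  have hc : ContinuousOn (fun u => q * X u) (Set.Icc (x - δ) (x + δ)) := by
    have hX : ContinuousOn X (Set.Icc α β) := HasDerivAt.continuousOn h.hasDerivAt_X
    exact continuousOn_const.mul (hX.mono (Set.Icc_subset_Icc hα hβ))
  obtain ⟨z, hz, hze⟩ := intermediate_value_Icc (by linarith) hc (show (p : ℝ) ∈ _ from by
    constructor
    · have : q * (m * (x - (x - δ))) ≤ q * (X x - X (x - δ)) := by gcongr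
      nlinarith
    · have : q * (m * (x + δ - x)) ≤ q * (X (x + δ) - X x) := by gcongr
      nlinarith)
  have hzx : |z - x| ≤ δ := by rw [abs_le]; constructor <;> linarith [hz.1, hz.2]
  refine ⟨z, hzx, q, hq, hqQ, hκq, p, r, hze, ?_⟩
  have hT := h.abs_taylor_le hxI (z := z) ⟨by linarith [hz.1], by linarith [hz.2]⟩
  have e : q * Y z - r = q * (Y z - Y x - σ x * (X z - X x)) +
      (q * Y x - r - σ x * (q * X x - p)) := by
    simp only at hze
    linear_combination σ x * hze
  have hM : 0 < M := h.pos.trans_le h.le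
  have h3 : q * (M ^ 2 * δ ^ 2) ≤ 1 / D := by
    calc q * (M ^ 2 * δ ^ 2) ≤ Q * (M ^ 2 * δ ^ 2) := by gcongr
      _ = 4 * M ^ 2 * D ^ 3 / (κ ^ 2 * m ^ 2 * Q ^ 3) * (1 / D) := by rw [hδ]; field_simp; ring
      _ ≤ 1 * (1 / D) := by gcongr; exact (div_le_one (by positivity)).2 hDQ
      _ = _ := one_mul _
  calc |q * Y z - r| ≤ |q * (Y z - Y x - σ x * (X z - X x))| +
        |q * Y x - r - σ x * (q * X x - p)| := by rw [e]; exact abs_add_le _ _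
    _ ≤ q * (M ^ 2 * δ ^ 2) + 1 / D := by
      rw [abs_mul, Nat.abs_cast]
      gcongr
      exact hT.trans (by gcongr)
    _ ≤ 1 / D + 1 / D := by gcongr
    _ = _ := by ring

end Ubiquity

section Selection

theorem exists_separated_finset {G : Set ℝ} {d : ℝ} (hd : 0 < d) (N : ℕ)
    (h : ENNReal.ofReal (N * (2 * d)) ≤ volume G) :
    ∃ F : Finset ℝ, ↑F ⊆ G ∧ F.card = N ∧ ∀ x ∈ F, ∀ y ∈ F, x ≠ y → d ≤ |x - y| := by
  induction N with
  | zero => exact ⟨∅, by simp⟩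
  | succ k ih =>
    obtain ⟨F, hFG, hF, hsep⟩ := ih (le_trans (ENNReal.ofReal_le_ofReal (by
      push_cast; nlinarith)) h)
    have hlt : volume (⋃ x ∈ F, Metric.ball x d) < volume G := by
      refine lt_of_le_of_lt ?_ (lt_of_lt_of_le ?_ h) (b := ENNReal.ofReal (k * (2 * d)))
      · refine (measure_biUnion_finset_le _ _).trans ?_
        rw [Finset.sum_congr rfl fun x _ => Real.volume_ball x d, Finset.sum_const, hF,
          nsmul_eq_mul, ENNReal.ofReal_mul (Nat.cast_nonneg k), ENNReal.ofReal_natCast]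
      · rw [ENNReal.ofReal_lt_ofReal_iff (by positivity)]
        push_cast; nlinarith
    obtain ⟨y, hyG, hy⟩ : ∃ y ∈ G, y ∉ ⋃ x ∈ F, Metric.ball x d := by
      by_contra! hcon
      exact absurd (measure_mono hcon) (not_le.2 hlt)
    simp only [Set.mem_iUnion, Metric.mem_ball, not_exists, not_lt, Real.dist_eq] at hy
    have hyF : y ∉ F := fun hmem => by
      have := hy y hmem
      simp at this
      linarith
    refine ⟨insert y F, ?_, by rw [Finset.card_insert_of_notMem hyF, hF], ?_⟩
    · rw [Finset.coe_insert]; exact Set.insert_subset hyG hFG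
    · intro a ha b hb hab
      rw [Finset.mem_insert] at ha hb
      rcases ha with rfl | ha <;> rcases hb with rfl | hb
      · exact absurd rfl hab
      · exact hy b hb
      · rw [abs_sub_comm]; exact hy a ha
      · exact hsep a ha b hb hab

/-- The union of a finite family of closed balls, given by centres and radii. -/
def ballUnion (P : Finset (ℝ × ℝ)) : Set ℝ := ⋃ p ∈ P, Metric.closedBall p.1 p.2

theorem volume_ballUnion_ne_top (P : Finset (ℝ × ℝ)) : volume (ballUnion P) ≠ ⊤ :=
  ((measure_biUnion_lt_top P.finite_toSet fun _ _ => measure_closedBall_lt_top)).ne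

theorem mem_ballUnion {P : Finset (ℝ × ℝ)} {x : ℝ} :
    x ∈ ballUnion P ↔ ∃ p ∈ P, |x - p.1| ≤ p.2 := by
  simp only [ballUnion, Set.mem_iUnion, exists_prop, Metric.mem_closedBall, Real.dist_eq]

theorem volume_real_biUnion_ball {ι : Type*} (Z : Finset ι) (c : ι → ℝ) {r : ℝ} (hr : 0 ≤ r)
    (h : ∀ x ∈ Z, ∀ y ∈ Z, x ≠ y → Disjoint (Metric.closedBall (c x) r) (Metric.closedBall (c y) r)) :
    volume.real (⋃ x ∈ Z, Metric.closedBall (c x) r) = Z.card * (2 * r) := by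
  rw [measureReal_biUnion_finset (fun x hx y hy hxy => h x hx y hy hxy)
    (fun _ _ => measurableSet_closedBall) (fun _ _ => measure_closedBall_lt_top.ne)]
  simp [Real.volume_real_closedBall hr]

/-- Few well separated balls can meet a small union of a few balls. -/
theorem card_filter_meets_le (P : Finset (ℝ × ℝ)) (Z : Finset ℝ) {r s T : ℝ} (hs : 0 < s)
    (hrs : r ≤ s) (hsep : ∀ x ∈ Z, ∀ y ∈ Z, x ≠ y → 4 * s ≤ |x - y|)
    (hT : volume.real (ballUnion P) ≤ T) :
    open scoped Classical in
    ((Z.filter fun z => ¬ Disjoint (Metric.closedBall z r) (ballUnion P)).card : ℝ) ≤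
      2 * P.card + T / (4 * s) := by
  classical
  set E : Finset ℝ := P.image (fun p => p.1 - p.2) ∪ P.image (fun p => p.1 + p.2) with hE
  have hEcard : E.card ≤ 2 * P.card := by
    refine (Finset.card_union_le _ _).trans ?_
    have h1 := Finset.card_image_le (s := P) (f := fun p => p.1 - p.2)
    have h2 := Finset.card_image_le (s := P) (f := fun p => p.1 + p.2)
    omega
  set Z₁ := Z.filter fun z => ∃ e ∈ E, |e - z| < 2 * s with hZ₁
  set Z₂ := Z.filter fun z => Metric.ball z (2 * s) ⊆ ballUnion P with hZ₂
  have hsub : (Z.filter fun z => ¬ Disjoint (Metric.closedBall z r) (ballUnion P)) ⊆ Z₁ ∪ Z₂ := by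
    intro z hz
    rw [Finset.mem_filter, Set.not_disjoint_iff] at hz
    obtain ⟨hzZ, y, hy, hyU⟩ := hz
    obtain ⟨p, hp, hyp⟩ := mem_ballUnion.1 hyU
    rw [Metric.mem_closedBall, Real.dist_eq, abs_le] at hy
    rw [abs_le] at hyp
    rw [Finset.mem_union, Finset.mem_filter, Finset.mem_filter]
    by_cases h1 : z - 2 * s < p.1 - p.2
    · refine Or.inl ⟨hzZ, p.1 - p.2, ?_, ?_⟩
      · exact Finset.mem_union_left _ (Finset.mem_image_of_mem (fun p : ℝ × ℝ => p.1 - p.2) hp)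
      · rw [abs_lt]; constructor <;> linarith
    by_cases h2 : p.1 + p.2 < z + 2 * s
    · refine Or.inl ⟨hzZ, p.1 + p.2, ?_, ?_⟩
      · exact Finset.mem_union_right _ (Finset.mem_image_of_mem (fun p : ℝ × ℝ => p.1 + p.2) hp)
      · rw [abs_lt]; constructor <;> linarith
    refine Or.inr ⟨hzZ, fun x hx => mem_ballUnion.2 ⟨p, hp, ?_⟩⟩
    rw [Metric.mem_ball, Real.dist_eq, abs_lt] at hx
    rw [abs_le]; constructor <;> linarith
  have h₁ : Z₁.card ≤ E.card := by
    have hch : ∀ z, ∃ e, z ∈ Z₁ → e ∈ E ∧ |e - z| < 2 * s := fun z => by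
      by_cases hz : z ∈ Z₁
      · obtain ⟨-, e, he, h⟩ := Finset.mem_filter.1 hz
        exact ⟨e, fun _ => ⟨he, h⟩⟩
      · exact ⟨0, fun h => absurd h hz⟩
    choose e he using hch
    refine Finset.card_le_card_of_injOn e (fun z hz => (he z hz).1) ?_
    intro a ha b hb hab
    by_contra hne
    have h3 := (he a ha).2
    have h4 := (he b hb).2
    rw [← hab] at h4
    have h5 := hsep a (Finset.mem_filter.1 ha).1 b (Finset.mem_filter.1 hb).1 hne
    have h6 : |a - b| ≤ |e a - a| + |e a - b| := by
      rw [abs_sub_comm (e a) a]; exact abs_sub_le a (e a) b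
    linarith
  have h₂ : (Z₂.card : ℝ) ≤ T / (4 * s) := by
    rw [le_div_iff₀ (by positivity)]
    refine le_trans ?_ hT
    have hm : volume.real (⋃ z ∈ Z₂, Metric.ball z (2 * s)) = Z₂.card * (4 * s) := by
      rw [measureReal_biUnion_finset (fun x hx y hy hxy => ?_) (fun _ _ => measurableSet_ball)
        (fun _ _ => measure_ball_lt_top.ne)]
      · simp only [Real.volume_real_ball (show 0 ≤ 2 * s by positivity), Finset.sum_const,
          nsmul_eq_mul]
        ring
      · refine Metric.ball_disjoint_ball ?_
        rw [Real.dist_eq]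
        linarith [hsep x (Finset.mem_filter.1 hx).1 y (Finset.mem_filter.1 hy).1 hxy]
    rw [← hm]
    refine measureReal_mono (Set.iUnion₂_subset fun z hz => (Finset.mem_filter.1 hz).2)
      (volume_ballUnion_ne_top P)
  have h₃ : ((Z.filter fun z => ¬ Disjoint (Metric.closedBall z r) (ballUnion P)).card : ℝ) ≤
      Z₁.card + Z₂.card := by
    exact_mod_cast (Finset.card_le_card hsub).trans (Finset.card_union_le _ _)
  have h₄ : (Z₁.card : ℝ) ≤ 2 * P.card := by exact_mod_cast h₁.trans hEcard
  linarith

open scoped Classical in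
theorem volume_ballUnion_union_ge (P : Finset (ℝ × ℝ)) (Z : Finset ℝ) {r s T : ℝ} (hr : 0 < r)
    (hrs : r ≤ s) (hsep : ∀ x ∈ Z, ∀ y ∈ Z, x ≠ y → 4 * s ≤ |x - y|)
    (hT : volume.real (ballUnion P) ≤ T) :
    volume.real (ballUnion P) + (Z.card - 2 * P.card - T / (4 * s)) * (2 * r) ≤
      volume.real (ballUnion (P ∪ Z.image fun z => (z, r))) := by
  have hs : 0 < s := hr.trans_le hrs
  set A := Z.filter fun z => Disjoint (Metric.closedBall z r) (ballUnion P)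
  have hA : (Z.card : ℝ) - (2 * P.card + T / (4 * s)) ≤ A.card := by
    have h1 := card_filter_meets_le P Z hs hrs hsep hT
    have h2 := Finset.card_filter_add_card_filter_not (s := Z)
      fun z => Disjoint (Metric.closedBall z r) (ballUnion P)
    have h3 : (Z.card : ℝ) = A.card +
        (Z.filter fun z => ¬ Disjoint (Metric.closedBall z r) (ballUnion P)).card := by
      exact_mod_cast h2.symm
    linarith
  have hvol : volume.real (⋃ z ∈ A, Metric.closedBall z r) = A.card * (2 * r) := by
    refine volume_real_biUnion_ball A id hr.le fun x hx y hy hxy => ?_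
    refine Metric.closedBall_disjoint_closedBall ?_
    rw [id, id, Real.dist_eq]
    linarith [hsep x (Finset.mem_filter.1 hx).1 y (Finset.mem_filter.1 hy).1 hxy]
  have hdisj : Disjoint (ballUnion P) (⋃ z ∈ A, Metric.closedBall z r) := by
    rw [Set.disjoint_iUnion₂_right]
    exact fun z hz => (Finset.mem_filter.1 hz).2.symm
  have hU : volume.real (ballUnion P ∪ ⋃ z ∈ A, Metric.closedBall z r) =
      volume.real (ballUnion P) + A.card * (2 * r) := by
    rw [← hvol]
    exact measureReal_union hdisj (A.measurableSet_biUnion fun _ _ => measurableSet_closedBall)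
      (volume_ballUnion_ne_top P)
      (measure_biUnion_lt_top A.finite_toSet fun _ _ => measure_closedBall_lt_top).ne
  calc _ ≤ volume.real (ballUnion P) + A.card * (2 * r) := by
        gcongr; linarith
    _ = _ := hU.symm
    _ ≤ _ := by
      refine measureReal_mono ?_ (volume_ballUnion_ne_top _)
      refine Set.union_subset (fun x hx => ?_) (Set.iUnion₂_subset fun z hz x hx => ?_)
      · obtain ⟨p, hp, h⟩ := mem_ballUnion.1 hx
        exact mem_ballUnion.2 ⟨p, Finset.mem_union_left _ hp, h⟩
      · exact mem_ballUnion.2 ⟨(z, r), Finset.mem_union_right _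
          (Finset.mem_image_of_mem (fun z => (z, r)) (Finset.mem_filter.1 hz).1), hx⟩

/-- Levels of well separated balls of growing cardinality whose total length diverges cover a
definite length. -/
theorem exists_le_volume_of_levels (Z : ℕ → Finset ℝ) (r s : ℕ → ℝ) (T : ℝ)
    (hr : ∀ n, 0 < r n) (hrs : ∀ n, r n ≤ s n)
    (hsep : ∀ n, ∀ x ∈ Z n, ∀ y ∈ Z n, x ≠ y → 4 * s n ≤ |x - y|)
    (hcard : ∀ n, (Z n).Nonempty → 8 * ∑ m ∈ Finset.range n, ((Z m).card : ℝ) ≤ (Z n).card ∧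
      T ≤ s n * (Z n).card)
    (hdiv : ¬ Summable fun n => ((Z n).card : ℝ) * r n) :
    ∃ n, T ≤ volume.real (⋃ m ∈ Finset.range n, ⋃ z ∈ Z m, Metric.closedBall z (r m)) := by
  classical
  by_contra! hcon
  apply hdiv
  let P : ℕ → Finset (ℝ × ℝ) := fun n =>
    (Finset.range n).biUnion fun m => (Z m).image fun z => (z, r m)
  have hP : ∀ n, ballUnion (P n) =
      ⋃ m ∈ Finset.range n, ⋃ z ∈ Z m, Metric.closedBall z (r m) := by
    intro n
    ext x
    simp only [mem_ballUnion, P, Finset.mem_biUnion, Finset.mem_image, Set.mem_iUnion,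
      Metric.mem_closedBall, Real.dist_eq, exists_prop]
    constructor
    · rintro ⟨_, ⟨m, hm, z, hz, rfl⟩, h⟩
      exact ⟨m, hm, z, hz, h⟩
    · rintro ⟨m, hm, z, hz, h⟩
      exact ⟨_, ⟨m, hm, z, hz, rfl⟩, h⟩
  have hPcard : ∀ n, ((P n).card : ℝ) ≤ ∑ m ∈ Finset.range n, ((Z m).card : ℝ) := by
    intro n
    have : (P n).card ≤ ∑ m ∈ Finset.range n, (Z m).card :=
      Finset.card_biUnion_le.trans (Finset.sum_le_sum fun m _ => Finset.card_image_le)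
    exact_mod_cast this
  have hPsucc : ∀ n, P (n + 1) = P n ∪ (Z n).image fun z => (z, r n) := by
    intro n
    simp only [P]
    rw [Finset.range_add_one, Finset.biUnion_insert, Finset.union_comm]
  have hlt : ∀ n, volume.real (ballUnion (P n)) < T := fun n => by rw [hP]; exact hcon n
  refine summable_of_sum_range_le (c := T) (fun n => by have := hr n; positivity) fun n => ?_
  refine le_trans ?_ (hlt n).le
  induction n with
  | zero => simp
  | succ n ih =>
    rw [Finset.sum_range_succ, hPsucc]
    have hs : 0 < s n := (hr n).trans_le (hrs n)
    rcases (Z n).eq_empty_or_nonempty with h0 | h0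
    · simpa [h0] using ih
    · refine le_trans ?_ (volume_ballUnion_union_ge (P n) (Z n) (hr n) (hrs n) (hsep n) (hlt n).le)
      obtain ⟨h1, h2⟩ := hcard n h0
      have h3 : T / (4 * s n) ≤ (Z n).card / 4 := by
        rw [div_le_iff₀ (by positivity)]; linarith
      have h4 := hPcard n
      have h5 : ((Z n).card : ℝ) * r n ≤
          ((Z n).card - 2 * (P n).card - T / (4 * s n)) * (2 * r n) := by
        have := hr n
        calc ((Z n).card : ℝ) * r n = ((Z n).card / 2) * (2 * r n) := by ring
          _ ≤ _ := by gcongr; linarith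
      linarith
end Selection

section Sequences

/-- Restricting a divergent series to the records of an auxiliary sequence keeps it divergent, if
the terms decay geometrically after each record. -/
theorem not_summable_indicator_records {w e : ℕ → ℝ} {θ : ℝ} {T : Set ℕ} (hw : ∀ n, 0 ≤ w n)
    (hθ : 0 ≤ θ) (hθ' : θ < 1) (hdec : ∀ m n, m ≤ n → e n ≤ e m → w n ≤ θ ^ (n - m) * w m)
    (h : ¬ Summable (T.indicator w)) :
    ¬ Summable ({n | n ∈ T ∧ ∀ m ∈ T, m < n → e m ≤ e n}.indicator w) := by
  classical
  set S := {n | n ∈ T ∧ ∀ m ∈ T, m < n → e m ≤ e n} with hS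
  refine fun hsum => h ?_
  have hnn : ∀ n, 0 ≤ S.indicator w n := fun n => Set.indicator_nonneg (fun n _ => hw n) n
  have hprod := (summable_norm_sum_mul_antidiagonal_of_summable_norm (f := S.indicator w)
    (g := fun n => θ ^ n) hsum.norm (summable_geometric_of_lt_one hθ hθ').norm).of_norm
  refine hprod.of_nonneg_of_le (fun n => Set.indicator_nonneg (fun n _ => hw n) n) fun n => ?_
  have hterm : ∀ p ∈ Finset.HasAntidiagonal.antidiagonal n, 0 ≤ S.indicator w p.1 * θ ^ p.2 :=
    fun p _ => mul_nonneg (hnn _) (by positivity)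
  by_cases hn : n ∈ T
  · obtain ⟨j, hj, hmax⟩ := ((Finset.range (n + 1)).filter (· ∈ T)).exists_max_image e
      ⟨n, by simp [hn]⟩
    simp only [Finset.mem_filter, Finset.mem_range] at hj hmax
    have hjn : j ≤ n := by omega
    have hjS : j ∈ S := ⟨hj.2, fun m hm hlt => hmax m ⟨by omega, hm⟩⟩
    rw [Set.indicator_of_mem hn]
    calc w n ≤ θ ^ (n - j) * w j := hdec j n hjn (hmax n ⟨by omega, hn⟩)
      _ = S.indicator w (j, n - j).1 * θ ^ (j, n - j).2 := by
        rw [Set.indicator_of_mem hjS, mul_comm]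
      _ ≤ _ := Finset.single_le_sum hterm (by
        rw [Finset.HasAntidiagonal.mem_antidiagonal]; exact Nat.add_sub_cancel' hjn)
  · rw [Set.indicator_of_notMem hn]
    exact Finset.sum_nonneg hterm

theorem summable_of_min_le {w v : ℕ → ℝ} {c K : ℝ} (hw : ∀ n, 0 ≤ w n) (hc : 0 < c)
    (hv : Summable v) (h : ∀ᶠ n in Filter.atTop, min 1 (c * w n) ≤ K * v n) : Summable w := by
  have hKv := hv.mul_left K
  have hlt : ∀ᶠ n in Filter.atTop, K * v n < 1 :=
    hKv.tendsto_atTop_zero.eventually_lt_const one_pos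
  refine Summable.of_norm_bounded_eventually_nat (hKv.mul_left (1 / c)) ?_
  filter_upwards [h, hlt] with n h1 h2
  have h3 : c * w n ≤ K * v n := by
    rcases min_le_iff.1 h1 with h | h
    · linarith
    · exact h
  rw [Real.norm_of_nonneg (hw n), one_div, ← div_eq_inv_mul, le_div_iff₀ hc]
  linarith

theorem sum_range_pow_sub_le {θ : ℝ} (hθ : 0 ≤ θ) (hθ' : θ ≤ 1 / 17) (n : ℕ) :
    ∑ m ∈ Finset.range n, θ ^ (n - m) ≤ 1 / 16 := by
  induction n with
  | zero => simp
  | succ n ih =>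
    have : ∑ m ∈ Finset.range (n + 1), θ ^ (n + 1 - m) =
        θ * (∑ m ∈ Finset.range n, θ ^ (n - m) + 1) := by
      rw [Finset.sum_range_succ, mul_add, Finset.mul_sum]
      congr 1
      · refine Finset.sum_congr rfl fun m hm => ?_
        rw [Nat.succ_sub (Finset.mem_range.1 hm).le, pow_succ']
      · simp
    rw [this]
    nlinarith

end Sequences

section Level

variable {m M α β : ℝ} {X Y σ X' σ' : ℝ → ℝ}

set_option maxHeartbeats 2000000 in
/-- At a single scale `Q` there are many well separated intervals consisting of points which are
`(y₁, y₂)`-close to a rational point of denominator between `κ Q` and `Q`. -/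
theorem PlanarArc.exists_level (h : PlanarArc m M α β X Y σ X' σ') (hαβ : α < β)
    {ε : ℝ} (hε : 0 < ε) (hε' : ε ≤ 1 / 3)
    (hεC : 2 * (Besicovitch.multiplicity ℝ : ℝ) * ((1 + 2 * Besicovitch.multiplicity ℝ) *
        (2 * √(sublevelConst m M * (ε / (1 / 3))))) ≤ 1 / 2)
    {κ c₀ y₁ y₂ s θ L : ℝ} (hκ : κ = ε ^ 3 / 2) (hc₀ : c₀ = ε / (3 + M + M ^ 2)) (hy₁ : 0 < y₁)
    (hy : y₁ ≤ y₂) (hy₂ : y₂ ≤ 1) {Q : ℕ} (hs : s = 4 / (c₀ * κ * m * Q ^ 2 * y₂))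
    (hL : L = β - α) (hθ : θ = κ ^ 2 * m ^ 2 / (4 * M ^ 2))
    (hQ₁ : 4 / (c₀ * ε) ≤ Q * y₂) (hQ₂ : 4 / (c₀ * (ε * (m * (L / 2)))) ≤ Q * y₂)
    (hQ₃ : 2 / (c₀ * θ) ≤ Q * y₂) (hQ₄ : 64 / ε ^ 2 ≤ Q * y₂)
    (hQ₅ : 64 / (ε ^ 2 * (m * (L / 2))) ≤ Q * y₂)
    (hQ₆ : 64 / (ε ^ 2 * (m * (L / 2)) ^ 2) ≤ Q * y₂)
    (hQ₇ : 192 / (c₀ * κ * m * L) ≤ Q * y₂) :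
    ∃ Z : Finset ℝ, (∀ x ∈ Z, ∀ y ∈ Z, x ≠ y → 4 * s ≤ |x - y|) ∧
      L / (96 * s) ≤ Z.card ∧ Z.card ≤ L / (48 * s) ∧
      ∀ z ∈ Z, ∀ t, |t - z| ≤ min (c₀ * y₁ / Q) s → t ∈ Set.Icc α β ∧
        ∃ q : ℕ, 0 < q ∧ κ * Q ≤ q ∧ q ≤ Q ∧ ∃ p r : ℤ, |q * X t - p| < y₁ ∧ |q * Y t - r| < y₂ := by
  have hm := h.pos
  have hM : 0 < M := h.pos.trans_le h.le
  have hκ0 : 0 < κ := by rw [hκ]; positivity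
  have hc0 : 0 < c₀ := by rw [hc₀]; positivity
  have hy₂0 : 0 < y₂ := hy₁.trans_le hy
  have hθ0 : 0 < θ := by rw [hθ]; positivity
  have hL0 : 0 < L := by rw [hL]; linarith
  have hc : c₀ * (3 + M + M ^ 2) = ε := by rw [hc₀]; field_simp
  have hc' : 3 * c₀ + M * c₀ + M ^ 2 * c₀ = ε := by rw [← hc]; ring
  have hMc : 0 < M * c₀ := by positivity
  have hMc' : 0 < M ^ 2 * c₀ := by positivity
  have hcε : c₀ ≤ ε := by linarith
  have hQ0 : (0 : ℝ) < Q := by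
    have : 0 < (Q : ℝ) * y₂ := lt_of_lt_of_le (by positivity) hQ₁
    exact pos_of_mul_pos_left this hy₂0.le
  have hQn : 0 < Q := by exact_mod_cast hQ0
  have hQle : (Q : ℝ) * y₂ ≤ Q := mul_le_of_le_one_right hQ0.le hy₂
  have hκ1 : κ ≤ 1 := by
    rw [hκ]
    have : ε ^ 3 ≤ 1 := pow_le_one₀ hε.le (by linarith)
    linarith
  have hθ1 : θ ≤ 1 := by
    rw [hθ, div_le_one (by positivity)]
    have : κ ^ 2 ≤ 1 := pow_le_one₀ hκ0.le hκ1
    have : m ^ 2 ≤ M ^ 2 := by have := h.le; gcongr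
    calc κ ^ 2 * m ^ 2 ≤ 1 * M ^ 2 := by gcongr
      _ ≤ 4 * M ^ 2 := by linarith [sq_nonneg M]
  have hs0 : 0 < s := by rw [hs]; positivity
  set D : ℕ := ⌈1 / (c₀ * y₂)⌉₊ with hDdef
  have hD1 : 1 / (c₀ * y₂) ≤ D := Nat.le_ceil _
  have hone : 1 ≤ 1 / (c₀ * y₂) := by
    rw [le_div_iff₀ (by positivity), one_mul]
    exact mul_le_one₀ (by linarith) hy₂0.le hy₂
  have hD2 : (D : ℝ) ≤ 2 / (c₀ * y₂) := by
    have := (Nat.ceil_lt_add_one (show 0 ≤ 1 / (c₀ * y₂) by positivity)).le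
    calc (D : ℝ) ≤ 1 / (c₀ * y₂) + 1 := this
      _ ≤ 1 / (c₀ * y₂) + 1 / (c₀ * y₂) := by linarith
      _ = _ := by ring
  have hD0 : (0 : ℝ) < D := by linarith
  have hDn : 0 < D := by exact_mod_cast hD0
  have hDQ : ∀ θ' : ℝ, 0 < θ' → 2 / (c₀ * θ') ≤ Q * y₂ → D ≤ θ' * Q := by
    intro θ' hθ' hle
    refine hD2.trans ?_
    rw [div_le_iff₀ (by positivity)] at hle ⊢
    linarith
  have hDε : 1 ≤ D * ε := by
    have h1 : 1 / c₀ ≤ D := by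
      refine le_trans ?_ hD1
      gcongr
      exact mul_le_of_le_one_right hc0.le hy₂
    rw [div_le_iff₀ hc0] at h1
    exact h1.trans (by gcongr)
  have hDQ₁ : 2 * D ≤ Q * ε := by
    have := hDQ (ε / 2) (by positivity) (le_of_eq_of_le (by field_simp; ring) hQ₁)
    linarith
  have hDQ₂ : 2 * D ≤ Q * ε * (m * (L / 2)) := by
    have := hDQ (ε * (m * (L / 2)) / 2) (by positivity) (le_of_eq_of_le (by field_simp; ring) hQ₂)
    linarith
  have hDQ₃ : 4 * M ^ 2 * D ^ 3 ≤ κ ^ 2 * m ^ 2 * Q ^ 3 := by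
    have h1 := hDQ θ hθ0 hQ₃
    have h2 : θ * (4 * M ^ 2) = κ ^ 2 * m ^ 2 := by rw [hθ]; field_simp
    calc 4 * M ^ 2 * (D : ℝ) ^ 3 ≤ 4 * M ^ 2 * (θ * Q) ^ 3 := by gcongr
      _ = 4 * M ^ 2 * (θ ^ 3 * Q ^ 3) := by ring
      _ ≤ 4 * M ^ 2 * (θ * Q ^ 3) := by
        gcongr
        exact pow_le_of_le_one hθ0.le hθ1 (by norm_num)
      _ = _ := by rw [← h2]; ring
  have h64 : ∀ A, 0 < A → 64 / A ≤ Q * y₂ → 64 ≤ A * Q := fun A hA hle => by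
    rw [div_le_iff₀ hA] at hle
    calc 64 ≤ Q * y₂ * A := hle
      _ ≤ Q * A := by gcongr
      _ = A * Q := mul_comm _ _
  have hlen : (β - L / 4) - (α + L / 4) = L / 2 := by rw [hL]; ring
  have hvol := (h.mono (α' := α + L / 4) (β' := β - L / 4) (by linarith)
    (by linarith)).half_le_volume_isNear (by linarith) hε hε' hεC hDε hDQ₁ (by rwa [hlen])
    (h64 _ (by positivity) hQ₄)
    (by rw [hlen]; linarith [h64 _ (by positivity) hQ₅])
    (by rw [hlen]; linarith [h64 _ (by positivity) hQ₆])
  rw [hlen, ← hκ] at hvol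
  have hQy : (Q : ℝ) * y₂ ≤ Q ^ 2 * y₂ := by
    have : (1 : ℝ) ≤ Q := by exact_mod_cast hQn
    exact mul_le_mul_of_nonneg_right (le_self_pow₀ this two_ne_zero) hy₂0.le
  have hsL : 48 * s ≤ L := by
    have h1 := hQ₇.trans hQy
    rw [div_le_iff₀ (by positivity)] at h1
    rw [hs, mul_div_assoc', div_le_iff₀ (by positivity)]
    linarith
  set N : ℕ := ⌊L / (48 * s)⌋₊ with hN
  have hN1 : (N : ℝ) ≤ L / (48 * s) := Nat.floor_le (by positivity)
  have hN2 : L / (96 * s) ≤ N := by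
    have h1 := (Nat.lt_floor_add_one (L / (48 * s))).le
    have h2 : (1 : ℝ) ≤ N := by
      have : 1 ≤ N := Nat.le_floor (by rw [Nat.cast_one, le_div_iff₀ (by positivity)]; linarith)
      exact_mod_cast this
    have h3 : L / (96 * s) = L / (48 * s) / 2 := by field_simp; norm_num
    rw [h3]; linarith
  obtain ⟨F, hFG, hFcard, hFsep⟩ := exists_separated_finset (d := 6 * s) (by positivity) N
    (le_trans (ENNReal.ofReal_le_ofReal (by
      rw [le_div_iff₀ (by positivity)] at hN1; linarith)) hvol)
  set δ : ℝ := 2 * D / (κ * m * Q ^ 2) with hδ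
  have hδs : δ ≤ s := by
    rw [hδ, hs]
    calc 2 * (D : ℝ) / (κ * m * Q ^ 2) ≤ 2 * (2 / (c₀ * y₂)) / (κ * m * Q ^ 2) := by gcongr
      _ = _ := by field_simp; norm_num
  have hz : ∀ x, ∃ z, x ∈ F → |z - x| ≤ δ ∧ ∃ q : ℕ, 0 < q ∧ q ≤ Q ∧ κ * Q ≤ q ∧ ∃ p r : ℤ,
      q * X z = p ∧ |q * Y z - r| ≤ 2 / D := by
    intro x
    by_cases hx : x ∈ F
    · obtain ⟨hxI, hx'⟩ := hFG hx
      obtain ⟨z, hz⟩ := h.exists_eq_of_isNear hκ0 hQn hDn hDQ₃ hδ (by linarith [hxI.1])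
        (by linarith [hxI.2]) hx'
      exact ⟨z, fun _ => hz⟩
    · exact ⟨0, fun h => absurd h hx⟩
  choose z hz using hz
  have hzsep : ∀ x ∈ F, ∀ y ∈ F, x ≠ y → 4 * s ≤ |z x - z y| := by
    intro x hx y hy hxy
    have h1 := hFsep x hx y hy hxy
    have h2 := (hz x hx).1
    have h3 := (hz y hy).1
    have h4 : |x - y| ≤ |z x - x| + |z x - z y| + |z y - y| := by
      have e : x - y = -(z x - x) + (z x - z y) + (z y - y) := by ring
      rw [e, ← abs_neg (z x - x)]
      exact abs_add_three _ _ _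
    linarith
  have hinj : Set.InjOn z F := by
    intro x hx y hy hxy
    by_contra hne
    have := hzsep x hx y hy hne
    rw [hxy, sub_self, abs_zero] at this
    linarith
  have hcard : (F.image z).card = N := by rw [Finset.card_image_of_injOn hinj, hFcard]
  refine ⟨F.image z, ?_, by rw [hcard]; exact hN2, by rw [hcard]; exact hN1, ?_⟩
  · intro a ha b hb hab
    obtain ⟨x, hx, rfl⟩ := Finset.mem_image.1 ha
    obtain ⟨y, hy, rfl⟩ := Finset.mem_image.1 hb
    exact hzsep x hx y hy fun he => hab (by rw [he])
  · intro a ha t ht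
    obtain ⟨x, hx, rfl⟩ := Finset.mem_image.1 ha
    obtain ⟨hzx, q, hq, hqQ, hκq, p, r, hp, hr⟩ := hz x hx
    obtain ⟨ht1, ht2⟩ := le_min_iff.1 ht
    have hxI := (hFG hx).1
    have hzx' := abs_le.1 hzx
    have ht2' := abs_le.1 ht2
    have htI : t ∈ Set.Icc α β := ⟨by linarith [hxI.1], by linarith [hxI.2]⟩
    have hzI : z x ∈ Set.Icc α β := ⟨by linarith [hxI.1], by linarith [hxI.2]⟩
    refine ⟨htI, q, hq, hκq, hqQ, p, r, ?_, ?_⟩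
    · have hqQ' : (q : ℝ) ≤ Q := by exact_mod_cast hqQ
      have h1 := h.abs_X_sub_le hzI htI
      have e : q * X t - p = q * (X t - X (z x)) := by rw [← hp]; ring
      rw [e, abs_mul, Nat.abs_cast]
      calc q * |X t - X (z x)| ≤ Q * (M * (c₀ * y₁ / Q)) := by
            gcongr
            exact h1.trans (by gcongr)
        _ = (M * c₀) * y₁ := by field_simp
        _ < 1 * y₁ := by
            gcongr
            linarith
        _ = y₁ := one_mul _
    · have hqQ' : (q : ℝ) ≤ Q := by exact_mod_cast hqQ
      have h1 := h.abs_Y_sub_le hzI htI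
      have e : q * Y t - r = q * (Y t - Y (z x)) + (q * Y (z x) - r) := by ring
      have h2 : 2 / (D : ℝ) ≤ 2 * c₀ * y₂ := by
        rw [div_le_iff₀ (by positivity)] at hD1
        rw [div_le_iff₀ hD0]
        linarith
      have h3 : |q * (Y t - Y (z x))| ≤ M ^ 2 * c₀ * y₂ := by
        rw [abs_mul, Nat.abs_cast]
        calc q * |Y t - Y (z x)| ≤ Q * (M ^ 2 * (c₀ * y₁ / Q)) := by
              gcongr
              exact h1.trans (by gcongr)
          _ = M ^ 2 * c₀ * y₁ := by field_simp
          _ ≤ _ := by gcongr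
      rw [e]
      calc _ ≤ |q * (Y t - Y (z x))| + |q * Y (z x) - r| := abs_add_le _ _
        _ ≤ M ^ 2 * c₀ * y₂ + 2 * c₀ * y₂ := by linarith
        _ = (M ^ 2 * c₀ + 2 * c₀) * y₂ := by ring
        _ < 1 * y₂ := by
            gcongr
            linarith
        _ = y₂ := one_mul _

end Level

section Local

variable {m M α β : ℝ} {X Y σ X' σ' : ℝ → ℝ}

theorem eventually_le_mul_of_half_pow_le {a : ℕ} (ha : 17 ≤ a) {y₁ y₂ : ℕ → ℝ}
    (hy₂ : ∀ n, 0 < y₂ n) (K : ℝ) :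
    ∀ᶠ n in Filter.atTop, y₁ n ≤ y₂ n → (1 / 2 : ℝ) ^ n ≤ (a : ℝ) ^ (2 * n) * (y₁ n * y₂ n) →
      K ≤ (a : ℝ) ^ (2 * n) * y₂ n := by
  have ha' : (17 : ℝ) ≤ a := by exact_mod_cast ha
  filter_upwards [(tendsto_pow_atTop_atTop_of_one_lt (r := (2 : ℝ)) one_lt_two).eventually_ge_atTop
    (K ^ 2)] with n hn h1 h2
  refine (le_abs_self K).trans (abs_le_of_sq_le_sq ?_ (by have := hy₂ n; positivity))
  have h3 : (4 : ℝ) ^ n ≤ (a : ℝ) ^ (2 * n) := by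
    rw [pow_mul]; gcongr; nlinarith
  calc K ^ 2 ≤ 2 ^ n := hn
    _ = 4 ^ n * (1 / 2 : ℝ) ^ n := by rw [← mul_pow]; norm_num
    _ ≤ (a : ℝ) ^ (2 * n) * ((a : ℝ) ^ (2 * n) * (y₁ n * y₂ n)) := by gcongr
    _ ≤ (a : ℝ) ^ (2 * n) * ((a : ℝ) ^ (2 * n) * (y₂ n * y₂ n)) := by
      have := (hy₂ n).le
      gcongr
    _ = _ := by ring

theorem PlanarArc.exists_le_volume (h : PlanarArc m M α β X Y σ X' σ') (hαβ : α < β) {a : ℕ}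
    (ha : 17 ≤ a) {ψ₁ ψ₂ : ℕ → ℝ} (hψ₁ : ∀ q, 0 < ψ₁ q) (hψ₂ : ∀ q, 0 < ψ₂ q) (ha₁ : Antitone ψ₁)
    (ha₂ : Antitone ψ₂) (hle₂ : ∀ q, ψ₂ q ≤ 1)
    (hdiv : ¬ Summable ({n : ℕ | ψ₁ (a ^ (2 * n)) ≤ ψ₂ (a ^ (2 * n))}.indicator fun n =>
      (a : ℝ) ^ (2 * n) * (ψ₁ (a ^ (2 * n)) * ψ₂ (a ^ (2 * n))))) (n₀ : ℕ) :
    ∃ U : Set ℝ, MeasurableSet U ∧ U ⊆ Set.Icc α β ∧ (∀ t ∈ U, ∃ q : ℕ, 0 < q ∧ n₀ ≤ q ∧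
      ∃ p r : ℤ, |q * X t - p| < ψ₁ q ∧ |q * Y t - r| < ψ₂ q) ∧
      (β - α) / 96 ≤ volume.real U := by
  classical
  obtain ⟨ε, hε, hε', hεC⟩ := exists_nondivergence_const (m := m) (M := M)
  have hm := h.pos
  have hM : 0 < M := h.pos.trans_le h.le
  have ha' : (17 : ℝ) ≤ a := by exact_mod_cast ha
  have ha0 : (0 : ℝ) < a := by linarith
  obtain ⟨κ, hκ⟩ : ∃ κ, κ = ε ^ 3 / 2 := ⟨_, rfl⟩
  obtain ⟨c₀, hc₀⟩ : ∃ c₀, c₀ = ε / (3 + M + M ^ 2) := ⟨_, rfl⟩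
  obtain ⟨θ, hθ⟩ : ∃ θ, θ = κ ^ 2 * m ^ 2 / (4 * M ^ 2) := ⟨_, rfl⟩
  obtain ⟨L, hL⟩ : ∃ L, L = β - α := ⟨_, rfl⟩
  have hκ0 : 0 < κ := by rw [hκ]; positivity
  have hc0 : 0 < c₀ := by rw [hc₀]; positivity
  have hL0 : 0 < L := by rw [hL]; linarith
  set y₁ : ℕ → ℝ := fun n => ψ₁ (a ^ (2 * n)) with hy₁
  set y₂ : ℕ → ℝ := fun n => ψ₂ (a ^ (2 * n)) with hy₂
  have hy₁0 : ∀ n, 0 < y₁ n := fun n => hψ₁ _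
  have hy₂0 : ∀ n, 0 < y₂ n := fun n => hψ₂ _
  have hy₁a : Antitone y₁ := fun i j hij => ha₁ (Nat.pow_le_pow_right (by omega) (by omega))
  set w : ℕ → ℝ := fun n => (a : ℝ) ^ (2 * n) * (y₁ n * y₂ n) with hw
  have hw0 : ∀ n, 0 ≤ w n := fun n => by have := hy₁0 n; have := hy₂0 n; positivity
  set T : Set ℕ := {n | y₁ n ≤ y₂ n ∧ (1 / 2 : ℝ) ^ n ≤ w n} with hT
  have hTdiv : ¬ Summable (T.indicator w) := by
    refine fun hs => hdiv ?_
    refine (hs.add (summable_geometric_of_lt_one (r := (1 / 2 : ℝ)) (by norm_num)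
      (by norm_num))).of_nonneg_of_le (fun n => Set.indicator_nonneg (fun n _ => hw0 n) n)
      fun n => ?_
    have h2 : (0 : ℝ) < (1 / 2) ^ n := by positivity
    by_cases h1 : y₁ n ≤ y₂ n
    · rw [Set.indicator_of_mem (show n ∈ {n : ℕ | ψ₁ (a ^ (2 * n)) ≤ ψ₂ (a ^ (2 * n))} from h1)]
      by_cases h3 : (1 / 2 : ℝ) ^ n ≤ w n
      · rw [Set.indicator_of_mem (show n ∈ T from ⟨h1, h3⟩)]
        linarith
      · have := Set.indicator_nonneg (s := T) (fun n _ => hw0 n) n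
        change w n ≤ _
        linarith
    · rw [Set.indicator_of_notMem (show n ∉ {n : ℕ | ψ₁ (a ^ (2 * n)) ≤ ψ₂ (a ^ (2 * n))} from h1)]
      have := Set.indicator_nonneg (s := T) (fun n _ => hw0 n) n
      linarith
  set e : ℕ → ℝ := fun n => (a : ℝ) ^ (3 * n) * y₂ n with he
  have hpow : ∀ i j : ℕ, i ≤ j → (a : ℝ) ^ i = (1 / (a : ℝ)) ^ (j - i) * (a : ℝ) ^ j := by
    intro i j hij
    obtain ⟨k, rfl⟩ := Nat.exists_eq_add_of_le hij
    rw [Nat.add_sub_cancel_left, pow_add, one_div, inv_pow]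
    field_simp
  set S : Set ℕ := {n | n ∈ T ∧ ∀ m ∈ T, m < n → e m ≤ e n} with hS
  have hSdiv : ¬ Summable (S.indicator w) := by
    refine not_summable_indicator_records (θ := 1 / a) hw0 (by positivity)
      ((div_lt_one ha0).2 (by linarith)) (fun i j hij hle => ?_) hTdiv
    have h1 : ∀ n, (a : ℝ) ^ n * w n = e n * y₁ n := fun n => by
      simp only [hw, he]; ring
    have h2 : (a : ℝ) ^ j * w j ≤ (a : ℝ) ^ j * ((1 / (a : ℝ)) ^ (j - i) * w i) := by
      calc (a : ℝ) ^ j * w j = e j * y₁ j := h1 j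
        _ ≤ e i * y₁ i := by
          have := hy₂0 i; have := hy₁0 j; have := hy₁a hij
          gcongr
        _ = (a : ℝ) ^ i * w i := (h1 i).symm
        _ = _ := by rw [hpow i j hij]; ring
    exact le_of_mul_le_mul_left h2 (by positivity)
  set s : ℕ → ℝ := fun n => 4 / (c₀ * κ * m * ((a ^ (2 * n) : ℕ) : ℝ) ^ 2 * y₂ n) with hs
  have hs0 : ∀ n, 0 < s n := fun n => by have := hy₂0 n; positivity
  have hsinv : ∀ n, L / (48 * s n) = L * (c₀ * κ * m) / 192 * ((a : ℝ) ^ n * e n) := fun n => by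
    have := (hy₂0 n).ne'
    simp only [hs, he]; push_cast; field_simp; ring
  set r : ℕ → ℝ := fun n => min (c₀ * y₁ n / ((a ^ (2 * n) : ℕ) : ℝ)) (s n) with hr
  have hr0 : ∀ n, 0 < r n := fun n => by have := hy₁0 n; exact lt_min (by positivity) (hs0 n)
  obtain ⟨n₁, hn₁⟩ := Filter.eventually_atTop.1
    ((eventually_le_mul_of_half_pow_le ha (y₁ := y₁) hy₂0 (4 / (c₀ * ε))).and <|
    (eventually_le_mul_of_half_pow_le ha (y₁ := y₁) hy₂0 (4 / (c₀ * (ε * (m * (L / 2)))))).and <|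
    (eventually_le_mul_of_half_pow_le ha (y₁ := y₁) hy₂0 (2 / (c₀ * θ))).and <|
    (eventually_le_mul_of_half_pow_le ha (y₁ := y₁) hy₂0 (64 / ε ^ 2)).and <|
    (eventually_le_mul_of_half_pow_le ha (y₁ := y₁) hy₂0 (64 / (ε ^ 2 * (m * (L / 2))))).and <|
    (eventually_le_mul_of_half_pow_le ha (y₁ := y₁) hy₂0 (64 / (ε ^ 2 * (m * (L / 2)) ^ 2))).and <|
    (eventually_le_mul_of_half_pow_le ha (y₁ := y₁) hy₂0 (192 / (c₀ * κ * m * L))).and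
    (eventually_le_mul_of_half_pow_le ha (y₁ := y₁) hy₂0 (n₀ / κ)))
  have hlevel : ∀ n, ∃ Z : Finset ℝ, (n ∈ S ∧ n₁ ≤ n →
      (∀ x ∈ Z, ∀ y ∈ Z, x ≠ y → 4 * s n ≤ |x - y|) ∧
      L / (96 * s n) ≤ Z.card ∧ Z.card ≤ L / (48 * s n) ∧
      ∀ z ∈ Z, ∀ t, |t - z| ≤ r n → t ∈ Set.Icc α β ∧ ∃ q : ℕ, 0 < q ∧ n₀ ≤ q ∧
        ∃ p r : ℤ, |q * X t - p| < ψ₁ q ∧ |q * Y t - r| < ψ₂ q) ∧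
      (¬ (n ∈ S ∧ n₁ ≤ n) → Z = ∅) := by
    intro n
    by_cases hn : n ∈ S ∧ n₁ ≤ n
    swap
    · exact ⟨∅, fun h => absurd h hn, fun _ => rfl⟩
    obtain ⟨hy, hwn⟩ := hn.1.1
    obtain ⟨h1, h2, h3, h4, h5, h6, h7, h8⟩ := hn₁ n hn.2
    have hcast : ((a ^ (2 * n) : ℕ) : ℝ) = (a : ℝ) ^ (2 * n) := by push_cast; rfl
    obtain ⟨Z, hZ1, hZ2, hZ3, hZ4⟩ := h.exists_level hαβ hε hε' hεC hκ hc₀ (hy₁0 n) hy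
      (hle₂ _) (Q := a ^ (2 * n)) (s := s n) rfl hL hθ (by rw [hcast]; exact h1 hy hwn)
      (by rw [hcast]; exact h2 hy hwn) (by rw [hcast]; exact h3 hy hwn)
      (by rw [hcast]; exact h4 hy hwn) (by rw [hcast]; exact h5 hy hwn)
      (by rw [hcast]; exact h6 hy hwn) (by rw [hcast]; exact h7 hy hwn)
    refine ⟨Z, fun _ => ⟨hZ1, hZ2, hZ3, fun z hz t ht => ?_⟩, fun h => absurd hn h⟩
    obtain ⟨htI, q, hq, hκq, hqQ, p, r, hp, hr⟩ := hZ4 z hz t ht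
    refine ⟨htI, q, hq, ?_, p, r, hp.trans_le (ha₁ hqQ), hr.trans_le (ha₂ hqQ)⟩
    have h9 := h8 hy hwn
    rw [div_le_iff₀ hκ0] at h9
    have h10 : (a : ℝ) ^ (2 * n) * y₂ n * κ ≤ (a : ℝ) ^ (2 * n) * 1 * κ := by
      have : y₂ n ≤ 1 := hle₂ _
      gcongr
    rw [hcast] at hκq
    have : (n₀ : ℝ) ≤ q := by linarith
    exact_mod_cast this
  choose Z hZ hZ' using hlevel
  have hmem : ∀ n, (Z n).Nonempty → n ∈ S ∧ n₁ ≤ n := fun n hne => by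
    by_contra hn
    rw [hZ' n hn] at hne
    exact Finset.not_nonempty_empty hne
  obtain ⟨N, hN⟩ := exists_le_volume_of_levels Z r s (L / 96) hr0 (fun n => min_le_right _ _)
    (fun n x hx => (hZ n (hmem n ⟨x, hx⟩)).1 x hx) (fun n hn => by
      obtain ⟨hnS, hnn⟩ := hmem n hn
      obtain ⟨-, h2, h3, -⟩ := hZ n ⟨hnS, hnn⟩
      constructor
      · have hterm : ∀ k ∈ Finset.range n,
            ((Z k).card : ℝ) ≤ (1 / (a : ℝ)) ^ (n - k) * (L / (48 * s n)) := by
          intro k hk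
          have hk' := Finset.mem_range.1 hk
          rcases (Z k).eq_empty_or_nonempty with h0 | h0
          · rw [h0, Finset.card_empty, Nat.cast_zero]
            have := hs0 n
            positivity
          · obtain ⟨hkS, hkn⟩ := hmem k h0
            refine (hZ k ⟨hkS, hkn⟩).2.2.1.trans ?_
            have h4 : e k ≤ e n := hnS.2 k hkS.1 hk'
            rw [hsinv, hsinv, hpow k n hk'.le]
            calc L * (c₀ * κ * m) / 192 * ((1 / (a : ℝ)) ^ (n - k) * (a : ℝ) ^ n * e k)
                ≤ L * (c₀ * κ * m) / 192 * ((1 / (a : ℝ)) ^ (n - k) * (a : ℝ) ^ n * e n) := by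
                  gcongr
              _ = _ := by ring
        have hsum := Finset.sum_le_sum hterm
        rw [← Finset.sum_mul] at hsum
        have hθ' := sum_range_pow_sub_le (θ := 1 / (a : ℝ)) (by positivity)
          (one_div_le_one_div_of_le (by norm_num) ha') n
        have hpos : 0 < L / (48 * s n) := by have := hs0 n; positivity
        have hhalf : L / (96 * s n) = L / (48 * s n) / 2 := by
          have := (hs0 n).ne'
          field_simp; norm_num
        have := mul_le_mul_of_nonneg_right hθ' hpos.le
        linarith
      · have hs' := hs0 n
        rw [div_le_iff₀ (by positivity)] at h2
        linarith) (fun hsum => by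
      refine hSdiv (summable_of_min_le (c := c₀ ^ 2 * κ * m / 4) (K := 96 / L)
        (fun n => Set.indicator_nonneg (fun n _ => hw0 n) n) (by positivity) hsum ?_)
      filter_upwards [Filter.eventually_ge_atTop n₁] with n hn
      have hr' := (hr0 n).le
      by_cases hnS : n ∈ S
      · rw [Set.indicator_of_mem hnS]
        obtain ⟨-, h2, -, -⟩ := hZ n ⟨hnS, hn⟩
        have hs' := hs0 n
        have hrs : r n = min 1 (c₀ ^ 2 * κ * m / 4 * w n) * s n := by
          rw [min_mul_of_nonneg _ _ hs'.le, one_mul, min_comm]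
          simp only [hr]
          congr 1
          have := (hy₂0 n).ne'
          simp only [hs, hw]; push_cast; field_simp
        calc min 1 (c₀ ^ 2 * κ * m / 4 * w n) = 96 / L * (L / (96 * s n) * r n) := by
              rw [hrs]; field_simp
          _ ≤ _ := by gcongr
      · rw [Set.indicator_of_notMem hnS, mul_zero, min_eq_right zero_le_one]
        positivity)
  refine ⟨_, ?_, ?_, ?_, by rw [← hL]; exact hN⟩
  · exact Finset.measurableSet_biUnion _ fun _ _ =>
      Finset.measurableSet_biUnion _ fun _ _ => measurableSet_closedBall
  · intro t ht
    simp only [Set.mem_iUnion, exists_prop, Metric.mem_closedBall, Real.dist_eq] at ht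
    obtain ⟨n, -, z, hz, ht⟩ := ht
    exact ((hZ n (hmem n ⟨z, hz⟩)).2.2.2 z hz t ht).1
  · intro t ht
    simp only [Set.mem_iUnion, exists_prop, Metric.mem_closedBall, Real.dist_eq] at ht
    obtain ⟨n, -, z, hz, ht⟩ := ht
    exact ((hZ n (hmem n ⟨z, hz⟩)).2.2.2 z hz t ht).2

end Local

section Global

/-- A set that misses a fixed proportion of every subinterval is null. -/
theorem volume_eq_zero_of_exists_disjoint {V : Set ℝ} {α β c : ℝ} (hV : V ⊆ Set.Ioo α β)
    (hc : 0 < c) (h : ∀ α' β', α ≤ α' → α' < β' → β' ≤ β → ∃ U : Set ℝ, MeasurableSet U ∧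
      U ⊆ Set.Icc α' β' ∧ Disjoint V U ∧ (β' - α') * c ≤ volume.real U) : volume V = 0 := by
  rw [measure_eq_zero_iff_ae_notMem]
  filter_upwards [ae_imp_of_ae_restrict (Besicovitch.ae_tendsto_measure_inter_div volume V)]
    with x hx hxV
  have hlim := hx hxV
  have hx' := hV hxV
  have hev : ∀ᶠ r in nhdsWithin (0 : ℝ) (Set.Ioi 0), volume (V ∩ Metric.closedBall x r) /
      volume (Metric.closedBall x r) ≤ ENNReal.ofReal (1 - c) := by
    have hpos : 0 < min (x - α) (β - x) := lt_min (by linarith [hx'.1]) (by linarith [hx'.2])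
    filter_upwards [Ioo_mem_nhdsGT hpos] with r hr
    have hr1 := (lt_min_iff.1 hr.2).1
    have hr2 := (lt_min_iff.1 hr.2).2
    have hr0 : 0 < r := hr.1
    obtain ⟨U, hUm, hUs, hUd, hUv⟩ := h (x - r) (x + r) (by linarith) (by linarith) (by linarith)
    have hsub : V ∩ Metric.closedBall x r ⊆ Set.Icc (x - r) (x + r) \ U := fun y hy =>
      ⟨by rw [← Real.closedBall_eq_Icc]; exact hy.2, fun hyU => Set.disjoint_left.1 hUd hy.1 hyU⟩
    have hreal : volume.real (Set.Icc (x - r) (x + r) \ U) ≤ 2 * r * (1 - c) := by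
      rw [measureReal_sdiff hUs hUm measure_Icc_lt_top.ne, Real.volume_real_Icc_of_le (by linarith)]
      linarith
    have hle : volume (Set.Icc (x - r) (x + r) \ U) ≤ ENNReal.ofReal (2 * r * (1 - c)) := by
      rw [← ENNReal.ofReal_toReal (a := volume (Set.Icc (x - r) (x + r) \ U))
        (measure_ne_top_of_subset Set.sdiff_subset measure_Icc_lt_top.ne)]
      exact ENNReal.ofReal_le_ofReal hreal
    rw [Real.volume_closedBall]
    refine ENNReal.div_le_of_le_mul ((measure_mono hsub).trans (hle.trans ?_))
    rw [ENNReal.ofReal_mul (by linarith), mul_comm]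
  have h1 := le_of_tendsto hlim hev
  rw [ENNReal.one_le_ofReal] at h1
  linarith

variable {m M α β : ℝ} {X Y σ X' σ' : ℝ → ℝ}

theorem PlanarArc.volume_not_infinite_eq_zero (h : PlanarArc m M α β X Y σ X' σ') {a : ℕ}
    (ha : 17 ≤ a) {ψ₁ ψ₂ : ℕ → ℝ} (hψ₁ : ∀ q, 0 < ψ₁ q) (hψ₂ : ∀ q, 0 < ψ₂ q) (ha₁ : Antitone ψ₁)
    (ha₂ : Antitone ψ₂) (hle₂ : ∀ q, ψ₂ q ≤ 1)
    (hdiv : ¬ Summable ({n : ℕ | ψ₁ (a ^ (2 * n)) ≤ ψ₂ (a ^ (2 * n))}.indicator fun n =>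
      (a : ℝ) ^ (2 * n) * (ψ₁ (a ^ (2 * n)) * ψ₂ (a ^ (2 * n))))) :
    volume {t | t ∈ Set.Ioo α β ∧ ¬ {q : ℕ | 0 < q ∧
      ∃ p r : ℤ, |q * X t - p| < ψ₁ q ∧ |q * Y t - r| < ψ₂ q}.Infinite} = 0 := by
  refine measure_mono_null (t := ⋃ n₀ : ℕ, {t | t ∈ Set.Ioo α β ∧ ∀ q : ℕ, 0 < q → n₀ ≤ q →
      ¬ ∃ p r : ℤ, |q * X t - p| < ψ₁ q ∧ |q * Y t - r| < ψ₂ q}) ?_ ?_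
  · rintro t ⟨ht, hfin⟩
    obtain ⟨N, hN⟩ := (Set.not_infinite.1 hfin).bddAbove
    refine Set.mem_iUnion.2 ⟨N + 1, ht, fun q hq hNq hex => ?_⟩
    have := hN (show q ∈ _ from ⟨hq, hex⟩)
    omega
  · refine measure_iUnion_null fun n₀ => volume_eq_zero_of_exists_disjoint (c := 1 / 96)
      (fun t ht => ht.1) (by norm_num) fun α' β' hα hαβ hβ => ?_
    obtain ⟨U, hUm, hUs, hUq, hUv⟩ := (h.mono hα hβ).exists_le_volume hαβ ha hψ₁ hψ₂ ha₁ ha₂ hle₂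
      hdiv n₀
    refine ⟨U, hUm, hUs, Set.disjoint_left.2 fun t ht htU => ?_, by linarith⟩
    obtain ⟨q, hq, hnq, hex⟩ := hUq t htU
    exact ht.2 q hq hnq hex

theorem nint_lt_of_abs_sub_lt {x δ : ℝ} {z : ℤ} (h : |x - z| < δ) : nint x < δ :=
  (ciInf_le ⟨0, by rintro _ ⟨w, rfl⟩; positivity⟩ z).trans_lt h

theorem nint_lt_of_abs_mul_sub_lt {s q x δ : ℝ} (hs : s = 1 ∨ s = -1) {z : ℤ}
    (h : |q * (s * x) - z| < δ) : nint (q * x) < δ := by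
  rcases hs with rfl | rfl
  · exact nint_lt_of_abs_sub_lt (z := z) (by simpa using h)
  · refine nint_lt_of_abs_sub_lt (z := -z) ?_
    rw [← abs_neg]
    convert h using 2
    push_cast
    ring

/-- Condensation of the divergence condition, split by which approximating function is smaller. -/
theorem not_summable_indicator_or {a : ℕ} (ha : 2 ≤ a) {ψ₁ ψ₂ : ℕ → ℝ} (hψ₁ : ∀ q, 0 < ψ₁ q)
    (hψ₂ : ∀ q, 0 < ψ₂ q) (ha₁ : Antitone ψ₁) (ha₂ : Antitone ψ₂)
    (hsum : ¬ Summable fun q => ψ₁ q * ψ₂ q) :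
    (¬ Summable ({n : ℕ | ψ₁ (a ^ (2 * n)) ≤ ψ₂ (a ^ (2 * n))}.indicator fun n =>
      (a : ℝ) ^ (2 * n) * (ψ₁ (a ^ (2 * n)) * ψ₂ (a ^ (2 * n))))) ∨
    ¬ Summable ({n : ℕ | ψ₂ (a ^ (2 * n)) ≤ ψ₁ (a ^ (2 * n))}.indicator fun n =>
      (a : ℝ) ^ (2 * n) * (ψ₂ (a ^ (2 * n)) * ψ₁ (a ^ (2 * n)))) := by
  by_contra! hcon
  obtain ⟨h1, h2⟩ := hcon
  refine hsum ((summable_schlomilch_iff_of_nonneg (C := a ^ 2) (u := fun n => a ^ (2 * n))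
    (fun n => (mul_pos (hψ₁ n) (hψ₂ n)).le)
    (fun i j _ hij => mul_le_mul (ha₁ hij) (ha₂ hij) (hψ₂ j).le (hψ₁ i).le)
    (fun n => by positivity)
    (fun i j hij => Nat.pow_lt_pow_right (by omega) (by omega)) (by positivity) ?_).1 ?_)
  · intro n
    have e1 : a ^ (2 * (n + 1 + 1)) = a ^ 2 * a ^ (2 * (n + 1)) := by ring
    have e2 : a ^ (2 * (n + 1)) = a ^ 2 * a ^ (2 * n) := by ring
    simp only [smul_eq_mul]
    rw [e1, Nat.mul_sub, ← e2]
  · refine Summable.of_nonneg_of_le (fun n => ?_) (fun n => ?_)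
      ((h1.add h2).mul_left ((a : ℝ) ^ 2))
    · have := hψ₁ (a ^ (2 * n))
      have := hψ₂ (a ^ (2 * n))
      have : ((a ^ (2 * n) : ℕ) : ℝ) ≤ (a ^ (2 * (n + 1)) : ℕ) := by
        exact_mod_cast Nat.pow_le_pow_right (by omega) (by omega)
      have := sub_nonneg.2 this
      positivity
    · have p1 := hψ₁ (a ^ (2 * n))
      have p2 := hψ₂ (a ^ (2 * n))
      obtain ⟨w, hw⟩ : ∃ w, w = (a : ℝ) ^ (2 * n) * (ψ₁ (a ^ (2 * n)) * ψ₂ (a ^ (2 * n))) :=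
        ⟨_, rfl⟩
      have hw0 : 0 ≤ w := by rw [hw]; positivity
      have hle : w ≤ Set.indicator {n : ℕ | ψ₁ (a ^ (2 * n)) ≤ ψ₂ (a ^ (2 * n))}
            (fun n => (a : ℝ) ^ (2 * n) * (ψ₁ (a ^ (2 * n)) * ψ₂ (a ^ (2 * n)))) n +
          Set.indicator {n : ℕ | ψ₂ (a ^ (2 * n)) ≤ ψ₁ (a ^ (2 * n))}
            (fun n => (a : ℝ) ^ (2 * n) * (ψ₂ (a ^ (2 * n)) * ψ₁ (a ^ (2 * n)))) n := by
        simp only [Set.indicator_apply, Set.mem_ofPred_eq, mul_comm (ψ₂ (a ^ (2 * n))), ← hw]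
        rcases le_total (ψ₁ (a ^ (2 * n))) (ψ₂ (a ^ (2 * n))) with h | h
        · rw [if_pos h]
          split_ifs <;> linarith
        · rw [if_pos h]
          split_ifs <;> linarith
      have hle' := mul_le_mul_of_nonneg_left hle (sq_nonneg (a : ℝ))
      refine le_trans ?_ hle'
      rw [hw, ← mul_assoc ((a : ℝ) ^ 2)]
      push_cast
      refine mul_le_mul_of_nonneg_right ?_ (by positivity)
      have : (0 : ℝ) ≤ (a : ℝ) ^ (2 * n) := by positivity
      calc _ ≤ (a : ℝ) ^ (2 * (n + 1)) := by linarith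
        _ = _ := by ring

variable {f f' f'' : ℝ → ℝ} {s k K c₁ c₂ : ℝ}

theorem planarArc_graph (hk : 0 < k) (hf : ∀ t ∈ Set.Icc α β, HasDerivAt f (f' t) t)
    (hf' : ∀ t ∈ Set.Icc α β, HasDerivAt f' (f'' t) t) (hc₂ : 0 < c₂)
    (hb : ∀ t ∈ Set.Icc α β, c₂ < f' t ∧ f' t < c₁)
    (hb' : ∀ t ∈ Set.Icc α β, k ≤ s * f'' t ∧ s * f'' t ≤ K) (hs : s = 1 ∨ s = -1) :
    PlanarArc (min 1 k) (max 1 (max K c₁)) α β id (fun t => s * f t) (fun t => s * f' t)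
      (fun _ => 1) fun t => s * f'' t where
  pos := lt_min one_pos hk
  le := (min_le_left _ _).trans (le_max_left _ _)
  hasDerivAt_X t _ := hasDerivAt_id t
  hasDerivAt_Y t ht := by simpa using (hf t ht).const_mul s
  hasDerivAt_slope t ht := (hf' t ht).const_mul s
  bounds_X t _ := ⟨min_le_left _ _, le_max_left _ _⟩
  bounds_slope t ht := ⟨(min_le_right _ _).trans (hb' t ht).1,
    (hb' t ht).2.trans ((le_max_left _ _).trans (le_max_right _ _))⟩
  abs_slope_le t ht := by
    have h1 := hb t ht
    have h2 : |s| = 1 := by rcases hs with rfl | rfl <;> simp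
    rw [abs_mul, h2, one_mul, abs_of_pos (hc₂.trans h1.1)]
    exact h1.2.le.trans ((le_max_right _ _).trans (le_max_right _ _))

theorem planarArc_inverse_graph (hk : 0 < k) (hf : ∀ t ∈ Set.Icc α β, HasDerivAt f (f' t) t)
    (hf' : ∀ t ∈ Set.Icc α β, HasDerivAt f' (f'' t) t) (hc₂ : 0 < c₂) (hc : c₂ < c₁)
    (hb : ∀ t ∈ Set.Icc α β, c₂ < f' t ∧ f' t < c₁)
    (hb' : ∀ t ∈ Set.Icc α β, k ≤ s * f'' t ∧ s * f'' t ≤ K) (hs : s = 1 ∨ s = -1) :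
    PlanarArc (min c₂ (k / c₁ ^ 2)) (max c₁ (max (K / c₂ ^ 2) (1 / c₂))) α β f
      (fun t => -s * id t) (fun t => -s * (f' t)⁻¹) f' fun t => s * f'' t / f' t ^ 2 where
  pos := lt_min hc₂ (div_pos hk (pow_pos (hc₂.trans hc) 2))
  le := (min_le_left _ _).trans (hc.le.trans (le_max_left _ _))
  hasDerivAt_X := hf
  hasDerivAt_Y t ht := by
    have h1 := (hc₂.trans (hb t ht).1).ne'
    refine ((hasDerivAt_id t).const_mul (-s)).congr_deriv ?_
    field_simp
  hasDerivAt_slope t ht := by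
    have h1 := (hc₂.trans (hb t ht).1).ne'
    exact (((hf' t ht).inv h1).const_mul (-s)).congr_deriv (by ring)
  bounds_X t ht := ⟨(min_le_left _ _).trans (hb t ht).1.le, (hb t ht).2.le.trans (le_max_left _ _)⟩
  bounds_slope t ht := by
    obtain ⟨h1, h2⟩ := hb t ht
    obtain ⟨h3, h4⟩ := hb' t ht
    have h0 : 0 < f' t := hc₂.trans h1
    refine ⟨(min_le_right _ _).trans ?_,
      le_trans ?_ ((le_max_left _ _).trans (le_max_right _ _))⟩
    · gcongr
      linarith
    · gcongr
      linarith
  abs_slope_le t ht := by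
    have h1 := hb t ht
    have h2 : |-s| = 1 := by rcases hs with rfl | rfl <;> simp
    rw [abs_mul, h2, one_mul, abs_of_pos (inv_pos.2 (hc₂.trans h1.1)), ← one_div]
    refine le_trans ?_ ((le_max_right _ _).trans (le_max_right _ _))
    gcongr
    exact h1.1.le

theorem volume_graph_not_infinite_eq_zero (hk : 0 < k)
    (hf : ∀ t ∈ Set.Icc α β, HasDerivAt f (f' t) t)
    (hf' : ∀ t ∈ Set.Icc α β, HasDerivAt f' (f'' t) t) (hc₂ : 0 < c₂) (hc : c₂ < c₁)
    (hb : ∀ t ∈ Set.Icc α β, c₂ < f' t ∧ f' t < c₁)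
    (hb' : ∀ t ∈ Set.Icc α β, k ≤ s * f'' t ∧ s * f'' t ≤ K) (hs : s = 1 ∨ s = -1)
    {ψ₁ ψ₂ : ℕ → ℝ} (hψ₁ : ∀ q, 0 < ψ₁ q) (hψ₂ : ∀ q, 0 < ψ₂ q) (ha₁ : Antitone ψ₁)
    (ha₂ : Antitone ψ₂) (hle₁ : ∀ q, ψ₁ q ≤ 1) (hle₂ : ∀ q, ψ₂ q ≤ 1)
    (hsum : ¬ Summable fun q => ψ₁ q * ψ₂ q) :
    volume {t | t ∈ Set.Ioo α β ∧ ¬ {q : ℕ | 0 < q ∧ nint (q * t) < ψ₁ q ∧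
      nint (q * f t) < ψ₂ q}.Infinite} = 0 := by
  rcases not_summable_indicator_or (a := 17) (by norm_num) hψ₁ hψ₂ ha₁ ha₂ hsum with hdiv | hdiv
  · refine measure_mono_null ?_ ((planarArc_graph hk hf hf' hc₂ hb hb' hs).volume_not_infinite_eq_zero
      le_rfl hψ₁ hψ₂ ha₁ ha₂ hle₂ hdiv)
    rintro t ⟨ht, hfin⟩
    refine ⟨ht, fun hinf => hfin (hinf.mono ?_)⟩
    rintro q ⟨hq, p, r, h1, h2⟩
    exact ⟨hq, nint_lt_of_abs_sub_lt h1, nint_lt_of_abs_mul_sub_lt hs h2⟩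
  · refine measure_mono_null ?_ ((planarArc_inverse_graph hk hf hf' hc₂ hc hb hb'
      hs).volume_not_infinite_eq_zero le_rfl hψ₂ hψ₁ ha₂ ha₁ hle₁ hdiv)
    rintro t ⟨ht, hfin⟩
    refine ⟨ht, fun hinf => hfin (hinf.mono ?_)⟩
    rintro q ⟨hq, p, r, h1, h2⟩
    refine ⟨hq, nint_lt_of_abs_mul_sub_lt (s := -s) ?_ h2, nint_lt_of_abs_sub_lt h1⟩
    rcases hs with rfl | rfl <;> simp

end Global

/-- **Beresnevich–Dickinson–Velani–Vaughan divergence theorem for planar curves**: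
if `Σ_q ψ₁(q) ψ₂(q) = ∞`, then for Lebesgue-almost every `x ∈ I` the point
`(x, f(x))` is simultaneously `(ψ₁, ψ₂)`-approximable, i.e. the set of `x ∈ I` for
which there are NOT infinitely many `q ∈ ℕ` with `‖qx‖ < ψ₁(q)` and
`‖q f(x)‖ < ψ₂(q)` is Lebesgue-null. -/
theorem bdvv_divergence
    (I : Set ℝ) (hIopen : IsOpen I) (hIconn : I.OrdConnected)
    (f : ℝ → ℝ) (hf : ContDiffOn ℝ 3 f I)
    (c₁ c₂ : ℝ) (hc₂pos : 0 < c₂) (hc₂₁ : c₂ < c₁)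
    (hderiv : ∀ x ∈ I, c₂ < deriv f x ∧ deriv f x < c₁)
    (hderiv2 : ∀ x ∈ I, iteratedDeriv 2 f x ≠ 0)
    (ψ₁ ψ₂ : ℕ → ℝ) (hψ₁pos : ∀ q, 0 < ψ₁ q) (hψ₁dec : Antitone ψ₁)
    (hψ₂pos : ∀ q, 0 < ψ₂ q) (hψ₂dec : Antitone ψ₂)
    (hsum : ¬ Summable (fun q : ℕ => ψ₁ q * ψ₂ q)) :
    volume {x : ℝ | x ∈ I ∧
      ¬ {q : ℕ | 0 < q ∧ nint (q * x) < ψ₁ q ∧ nint (q * f x) < ψ₂ q}.Infinite} = 0 := by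
  obtain ⟨C, hC⟩ : ∃ C, C = max 1 (max (ψ₁ 0) (ψ₂ 0)) := ⟨_, rfl⟩
  have hC1 : 1 ≤ C := hC ▸ le_max_left _ _
  have hC0 : 0 < C := by linarith
  have hCψ₁ : ∀ q, ψ₁ q ≤ C := fun q =>
    (hψ₁dec (Nat.zero_le q)).trans (hC ▸ (le_max_left _ _).trans (le_max_right _ _))
  have hCψ₂ : ∀ q, ψ₂ q ≤ C := fun q =>
    (hψ₂dec (Nat.zero_le q)).trans (hC ▸ (le_max_right _ _).trans (le_max_right _ _))
  have hsum' : ¬ Summable fun q => ψ₁ q / C * (ψ₂ q / C) := fun h =>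
    hsum ((h.mul_left (C ^ 2)).congr fun q => by field_simp)
  have hd1 : ContDiffOn ℝ 2 (deriv f) I := hf.deriv_of_isOpen hIopen (by norm_num)
  have hd2 : ContDiffOn ℝ 1 (deriv (deriv f)) I := hd1.deriv_of_isOpen hIopen (by norm_num)
  refine measure_null_of_locally_null _ fun x hx => ?_
  have hxI : x ∈ I := hx.1
  have hne : deriv (deriv f) x ≠ 0 := by
    simpa [iteratedDeriv_succ, iteratedDeriv_zero] using hderiv2 x hxI
  obtain ⟨s, hs, hspos⟩ : ∃ s : ℝ, (s = 1 ∨ s = -1) ∧ 0 < s * deriv (deriv f) x := by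
    rcases hne.lt_or_gt with h | h
    · exact ⟨-1, Or.inr rfl, by linarith⟩
    · exact ⟨1, Or.inl rfl, by linarith⟩
  have hcont : ContinuousAt (fun t => s * deriv (deriv f) t) x :=
    ((hd2.continuousOn.continuousAt (hIopen.mem_nhds hxI))).const_mul s
  have hev : ∀ᶠ t in nhds x, t ∈ I ∧ s * deriv (deriv f) x / 2 ≤ s * deriv (deriv f) t ∧
      s * deriv (deriv f) t ≤ 2 * (s * deriv (deriv f) x) := by
    filter_upwards [hIopen.mem_nhds hxI, hcont.eventually_const_le (half_lt_self hspos),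
      hcont.eventually_le_const (show _ < 2 * (s * deriv (deriv f) x) by linarith)]
      with t h1 h2 h3 using ⟨h1, h2, h3⟩
  obtain ⟨η, hη, hball⟩ := Metric.nhds_basis_closedBall.eventually_iff.1 hev
  simp only [Real.closedBall_eq_Icc] at hball
  refine ⟨_, Filter.inter_mem self_mem_nhdsWithin
    (mem_nhdsWithin_of_mem_nhds (Ioo_mem_nhds (sub_lt_self x hη) (lt_add_of_pos_right x hη))), ?_⟩
  refine measure_mono_null ?_ (volume_graph_not_infinite_eq_zero (half_pos hspos)
    (fun t ht => ((hf.differentiableOn (by norm_num)).differentiableAt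
      (hIopen.mem_nhds (hball ht).1)).hasDerivAt)
    (fun t ht => ((hd1.differentiableOn (by norm_num)).differentiableAt
      (hIopen.mem_nhds (hball ht).1)).hasDerivAt)
    hc₂pos hc₂₁ (fun t ht => hderiv t (hball ht).1) (fun t ht => (hball ht).2) hs
    (fun q => div_pos (hψ₁pos q) hC0) (fun q => div_pos (hψ₂pos q) hC0)
    (fun i j hij => div_le_div_of_nonneg_right (hψ₁dec hij) hC0.le)
    (fun i j hij => div_le_div_of_nonneg_right (hψ₂dec hij) hC0.le)
    (fun q => (div_le_one hC0).2 (hCψ₁ q)) (fun q => (div_le_one hC0).2 (hCψ₂ q)) hsum')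
  rintro t ⟨⟨-, hfin⟩, ht⟩
  refine ⟨ht, fun hinf => hfin (hinf.mono ?_)⟩
  rintro q ⟨hq, h1, h2⟩
  exact ⟨hq, h1.trans_le (div_le_self (hψ₁pos q).le hC1), h2.trans_le (div_le_self (hψ₂pos q).le hC1)⟩
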